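/- arXiv:math/0506536 — 2 statements merged into one kernel-verified Lean document; each statement's English description precedes it below -/
import Mathlib

section
/- Every 7-vertex 2-dimensional weak pseudomanifold with at most 10 facets is isomorphic to one of: a 7-vertex triangulation of the 2-sphere with 10 triangles (i.e., S¹₅ * S⁰₂ or one of the four other such triangulations Σ₂, …, Σ₅); Υ₁, the union of two standard 2-spheres S²₄ sharing exactly one vertex; or Υ₂, the union of a standard 2-sphere S²₄ and a join S⁰₂ * S¹₃ sharing exactly one edge. -/
/- Formalization of definitions from:
   B. Bagchi, B. Datta, "Combinatorial triangulations of homology spheres". -/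

open Finset

noncomputable section

attribute [local instance] Classical.propDecidable

namespace HomologySpheres

variable {V : Type*} [DecidableEq V] {W : Type*} [DecidableEq W]

/-- The vertex set of a finite family of finite sets. -/
def verts (K : Finset (Finset V)) : Finset V := K.sup id

/-- An (abstract, finite) simplicial complex: a nonempty collection of nonempty
finite sets closed under taking nonempty subsets. -/
def IsComplex (K : Finset (Finset V)) : Prop :=
  K.Nonempty ∧ ∅ ∉ K ∧ ∀ s ∈ K, ∀ t : Finset V, t ⊆ s → t.Nonempty → t ∈ K

/-- The facets (maximal faces) of `K`. -/
def facets (K : Finset (Finset V)) : Finset (Finset V) :=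
  K.filter fun s => ∀ t ∈ K, s ⊆ t → t = s

/-- `K` is pure of dimension `d`: every maximal face has `d + 1` vertices. -/
def IsPure (d : ℕ) (K : Finset (Finset V)) : Prop :=
  ∀ s ∈ facets K, s.card = d + 1

/-- The link of a face `σ` in `K`. -/
def link (K : Finset (Finset V)) (σ : Finset V) : Finset (Finset V) :=
  K.filter fun τ => Disjoint τ σ ∧ τ ∪ σ ∈ K

/-- `L` is an induced (full) subcomplex of `K`. -/
def IsInduced (K L : Finset (Finset V)) : Prop :=
  L ⊆ K ∧ ∀ s ∈ K, s ⊆ verts L → s ∈ L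

/-- The simplicial complement `C(L, K)`: the induced subcomplex of `K` on
`V(K) \ V(L)`. -/
def simpComplement (L K : Finset (Finset V)) : Finset (Finset V) :=
  K.filter fun s => s ⊆ verts K \ verts L

/-- The simplicial neighbourhood `N(L, K)`: the subcomplex of `K` whose maximal
faces are the maximal faces of `K` meeting `V(L)`. -/
def simpNbhd (L K : Finset (Finset V)) : Finset (Finset V) :=
  K.filter fun s => ∃ t ∈ facets K, s ⊆ t ∧ (t ∩ verts L).Nonempty

/-- `fvec K i` is the number of `i`-dimensional faces of `K`. -/
def fvec (K : Finset (Finset V)) (i : ℕ) : ℕ :=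
  (K.filter fun s => s.card = i + 1).card

/-- The number of facets of cardinality `d + 1` containing a given `(d-1)`-face
(the degree of the face in a (weak) pseudomanifold of dimension `d`). -/
def degOf (K : Finset (Finset V)) (d : ℕ) (s : Finset V) : ℕ :=
  (K.filter fun t => s ⊆ t ∧ t.card = d + 1).card

/-- Simplicial isomorphism (via a vertex bijection carrying faces to faces). -/
def Iso (K : Finset (Finset V)) (L : Finset (Finset W)) : Prop :=
  ∃ f : V → W, Set.InjOn f ↑(verts K) ∧ L = K.image (Finset.image f)

/-- The join of two simplicial complexes (on disjoint vertex sets). -/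
def sjoin (K L : Finset (Finset V)) : Finset (Finset V) :=
  K ∪ L ∪ (K ×ˢ L).image fun p => p.1 ∪ p.2

/-- The standard ball on vertex set `A`: all nonempty subsets of `A`. -/
def stdBall (A : Finset V) : Finset (Finset V) := A.powerset.erase ∅

/-- The standard sphere on vertex set `A`: all nonempty proper subsets of `A`. -/
def stdSphere (A : Finset V) : Finset (Finset V) := (A.powerset.erase ∅).erase A

/-- `τ` is a free face of `K`, with `σ` the unique face properly containing it. -/
def IsFreeFace (K : Finset (Finset V)) (τ σ : Finset V) : Prop :=
  τ ∈ K ∧ σ ∈ K ∧ τ ⊂ σ ∧ ∀ ρ ∈ K, τ ⊂ ρ → ρ = σ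

/-- An elementary collapse removes a free face together with the unique face
properly containing it. -/
def ElemCollapse (K K' : Finset (Finset V)) : Prop :=
  ∃ τ σ : Finset V, IsFreeFace K τ σ ∧ K' = (K.erase τ).erase σ

/-- `K` collapses to `L` by a sequence of elementary collapses. -/
def CollapsesTo (K L : Finset (Finset V)) : Prop :=
  Relation.ReflTransGen ElemCollapse K L

/-- `K` is collapsible: it collapses to a single vertex. -/
def Collapsible (K : Finset (Finset V)) : Prop :=
  ∃ v : V, CollapsesTo K {{v}}

/-! ### Simplicial homology with `ℤ/2` coefficients (augmented chain complex).
A chain of level `n` is a `ZMod 2`-valued function supported on the faces of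
cardinality `n` (the empty set, of cardinality `0`, serves as the `(-1)`-simplex
of the augmented complex).  Reduced homology in dimension `q` lives at level
`q + 1`. -/

/-- `c` is a chain of level `n` of `K` (over `ℤ/2`). -/
def z2chainOK (K : Finset (Finset V)) (n : ℕ) (c : Finset V → ZMod 2) : Prop :=
  ∀ s : Finset V, c s ≠ 0 → s.card = n ∧ (s ∈ K ∨ s = ∅)

/-- The mod-2 boundary operator. -/
def z2bdry (K : Finset (Finset V)) (c : Finset V → ZMod 2) : Finset V → ZMod 2 :=
  fun t => ∑ v ∈ verts K \ t, c (insert v t)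

/-- `K` is `ℤ/2`-acyclic: all reduced homology with `ℤ/2` coefficients vanishes,
i.e. in the augmented mod-2 chain complex every cycle is a boundary. -/
def Z2Acyclic (K : Finset (Finset V)) : Prop :=
  ∀ (n : ℕ) (c : Finset V → ZMod 2), z2chainOK K n c → z2bdry K c = 0 →
    ∃ c', z2chainOK K (n + 1) c' ∧ z2bdry K c' = c

/-- `K` has the reduced `ℤ/2`-homology of the `d`-sphere: reduced homology
vanishes in all dimensions except `d` (level `d + 1`), where it is `ℤ/2`
(there is a cycle `z` which is not a boundary, and modulo boundaries every
cycle is `0` or `z`). -/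
def Z2HomologySphere (d : ℕ) (K : Finset (Finset V)) : Prop :=
  (∀ (n : ℕ) (c : Finset V → ZMod 2), n ≠ d + 1 → z2chainOK K n c →
    z2bdry K c = 0 → ∃ c', z2chainOK K (n + 1) c' ∧ z2bdry K c' = c) ∧
  (∃ z : Finset V → ZMod 2, z2chainOK K (d + 1) z ∧ z2bdry K z = 0 ∧
    (∀ c', z2chainOK K (d + 2) c' → z2bdry K c' ≠ z) ∧
    (∀ z', z2chainOK K (d + 1) z' → z2bdry K z' = 0 →
      (∃ c', z2chainOK K (d + 2) c' ∧ z2bdry K c' = z') ∨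
      (∃ c', z2chainOK K (d + 2) c' ∧ z2bdry K c' = z + z')))

/-! ### Integral simplicial homology via ordered chains (Munkres §13: ordered
simplicial homology, allowing repeated vertices, agrees with simplicial
homology). An ordered `m`-tuple chain corresponds to dimension `m - 1`; the
unique `0`-tuple is the `(-1)`-simplex of the augmented complex. -/

/-- `c` is an ordered chain of `K` over `ℤ`: supported on tuples whose image is
a face (the empty tuple being allowed in level `0`). -/
def zchainOK (K : Finset (Finset V)) {m : ℕ} (c : (Fin m → V) → ℤ) : Prop :=
  ∀ x : Fin m → V, c x ≠ 0 → (Finset.univ.image x ∈ K ∨ m = 0)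

/-- The integral boundary operator on ordered chains. -/
def zbdry (K : Finset (Finset V)) {m : ℕ} (c : (Fin (m + 1) → V) → ℤ) :
    (Fin m → V) → ℤ :=
  fun y => ∑ i : Fin (m + 1), (-1 : ℤ) ^ (i : ℕ) * ∑ v ∈ verts K, c (i.insertNth v y)

/-- `K` has the reduced integral homology of the `d`-sphere: reduced homology
vanishes in all dimensions except `d`, where it is infinite cyclic (there is a
cycle `z` such that every cycle is, modulo boundaries, a unique multiple of `z`). -/
def ZHomologySphere (d : ℕ) (K : Finset (Finset V)) : Prop :=
  (∀ c : (Fin 0 → V) → ℤ, ∃ c' : (Fin 1 → V) → ℤ, zchainOK K c' ∧ zbdry K c' = c) ∧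
  (∀ (m : ℕ) (c : (Fin (m + 1) → V) → ℤ), m ≠ d → zchainOK K c → zbdry K c = 0 →
    ∃ c' : (Fin (m + 2) → V) → ℤ, zchainOK K c' ∧ zbdry K c' = c) ∧
  (∃ z : (Fin (d + 1) → V) → ℤ, zchainOK K z ∧ zbdry K z = 0 ∧
    ∀ z' : (Fin (d + 1) → V) → ℤ, zchainOK K z' → zbdry K z' = 0 →
      ∃! k : ℤ, ∃ c'' : (Fin (d + 2) → V) → ℤ,
        zchainOK K c'' ∧ zbdry K c'' = z' - k • z)

/-- A weak pseudomanifold of dimension `d`: pure, and every `(d-1)`-face is in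
exactly two facets. -/
def IsWeakPseudomanifold (d : ℕ) (K : Finset (Finset V)) : Prop :=
  IsComplex K ∧ IsPure d K ∧ ∀ s ∈ K, s.card = d → degOf K d s = 2

/-- Adjacency of facets along a common `(d-1)`-face. -/
def FacetAdj (d : ℕ) (K : Finset (Finset V)) (s t : Finset V) : Prop :=
  s ∈ K ∧ t ∈ K ∧ s.card = d + 1 ∧ t.card = d + 1 ∧ (s ∩ t).card = d

/-- A pseudomanifold: a weak pseudomanifold in which any two facets are joined
by a chain of facets, consecutive ones sharing a `(d-1)`-face. -/
def IsPseudomanifold (d : ℕ) (K : Finset (Finset V)) : Prop :=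
  IsWeakPseudomanifold d K ∧ ∀ s ∈ K, ∀ t ∈ K, s.card = d + 1 → t.card = d + 1 →
    Relation.ReflTransGen (FacetAdj d K) s t

/-- A weak pseudomanifold with boundary. -/
def IsWeakPseudomanifoldWithBdry (d : ℕ) (K : Finset (Finset V)) : Prop :=
  IsComplex K ∧ IsPure d K ∧
  (∀ s ∈ K, s.card = d → degOf K d s = 1 ∨ degOf K d s = 2) ∧
  (∃ s ∈ K, s.card = d ∧ degOf K d s = 1)

/-- The boundary complex: all faces of degree-one `(d-1)`-faces. -/
def bdryComplex (d : ℕ) (K : Finset (Finset V)) : Finset (Finset V) :=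
  K.filter fun t => ∃ s ∈ K, t ⊆ s ∧ s.card = d ∧ degOf K d s = 1

/-- `K` is connected (any two vertices joined by a path of edges). -/
def SConnected (K : Finset (Finset V)) : Prop :=
  ∀ u ∈ verts K, ∀ v ∈ verts K,
    Relation.ReflTransGen (fun a b : V => ({a, b} : Finset V) ∈ K) u v

/-! ### Geometric realizations, subdivisions and combinatorial equivalence. -/

/-- A geometric simplicial complex in `ℝ^ℕ`: finitely many geometric simplices
(affinely independent vertex sets), closed under faces, any two of which meet
in a common face. -/
structure GComplex where
  faces : Finset (Finset (ℕ → ℝ))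
  nonempty : faces.Nonempty
  empty_not_mem : ∅ ∉ faces
  down_closed : ∀ s ∈ faces, ∀ t : Finset (ℕ → ℝ), t ⊆ s → t.Nonempty → t ∈ faces
  indep : ∀ s ∈ faces,
    AffineIndependent ℝ (fun x : {y : ℕ → ℝ // y ∈ s} => (x : ℕ → ℝ))
  glue : ∀ s ∈ faces, ∀ t ∈ faces,
    convexHull ℝ (s : Set (ℕ → ℝ)) ∩ convexHull ℝ (t : Set (ℕ → ℝ)) =
      convexHull ℝ ((s ∩ t : Finset (ℕ → ℝ)) : Set (ℕ → ℝ))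

/-- The geometric carrier (underlying polyhedron) of a geometric complex. -/
def GComplex.carrier (G : GComplex) : Set (ℕ → ℝ) :=
  ⋃ s ∈ G.faces, convexHull ℝ (s : Set (ℕ → ℝ))

/-- `G` realizes the abstract complex `K` via the vertex map `f`. -/
def RealizesMap (G : GComplex) (K : Finset (Finset V)) (f : V → ℕ → ℝ) : Prop :=
  Set.InjOn f ↑(verts K) ∧ G.faces = K.image (Finset.image f)

/-- `G` is a geometric realization of the abstract complex `K`. -/
def Realizes (G : GComplex) (K : Finset (Finset V)) : Prop :=
  ∃ f : V → ℕ → ℝ, RealizesMap G K f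

/-- `G'` is a subdivision of `G`: same carrier, and every simplex of `G'` is
contained in a simplex of `G`. -/
def Subdivides (G' G : GComplex) : Prop :=
  G'.carrier = G.carrier ∧
  ∀ s ∈ G'.faces, ∃ t ∈ G.faces,
    convexHull ℝ (s : Set (ℕ → ℝ)) ⊆ convexHull ℝ (t : Set (ℕ → ℝ))

/-- Combinatorial equivalence: `K` and `L` admit isomorphic subdivisions. -/
def CombEquiv (K : Finset (Finset V)) (L : Finset (Finset W)) : Prop :=
  ∃ G1 G1' G2 G2' : GComplex, Realizes G1 K ∧ Realizes G2 L ∧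
    Subdivides G1' G1 ∧ Subdivides G2' G2 ∧ Iso G1'.faces G2'.faces

/-- A combinatorial `d`-ball: combinatorially equivalent to the standard ball. -/
def IsCombBall (d : ℕ) (K : Finset (Finset V)) : Prop :=
  ∃ A : Finset ℕ, A.card = d + 1 ∧ CombEquiv K (stdBall A)

/-- A combinatorial `d`-sphere: combinatorially equivalent to the standard sphere. -/
def IsCombSphere (d : ℕ) (K : Finset (Finset V)) : Prop :=
  ∃ A : Finset ℕ, A.card = d + 2 ∧ CombEquiv K (stdSphere A)

/-- A combinatorial `d`-manifold: every vertex link is a combinatorial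
`(d-1)`-sphere. -/
def IsCombManifold (d : ℕ) (K : Finset (Finset V)) : Prop :=
  IsComplex K ∧ ∀ v ∈ verts K, IsCombSphere (d - 1) (link K {v})

/-- A combinatorial `d`-manifold with boundary. -/
def IsCombManifoldWithBdry (d : ℕ) (K : Finset (Finset V)) : Prop :=
  IsComplex K ∧
  (∀ v ∈ verts K, IsCombSphere (d - 1) (link K {v}) ∨
    IsCombBall (d - 1) (link K {v})) ∧
  (∃ v ∈ verts K, IsCombBall (d - 1) (link K {v}))

/-- A pl `k`-ball: a polyhedron carried by some geometric complex whose face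
structure is a combinatorial `k`-ball. -/
def IsPLBall (k : ℕ) (P : Set (ℕ → ℝ)) : Prop :=
  ∃ G : GComplex, G.carrier = P ∧ IsCombBall k G.faces

/-- Elementary polyhedral collapse: `P = P' ∪ B` with `B` a pl `k`-ball and
`P' ∩ B` a pl `(k-1)`-ball. -/
def PolyElemCollapse (P P' : Set (ℕ → ℝ)) : Prop :=
  ∃ k : ℕ, 1 ≤ k ∧ ∃ B : Set (ℕ → ℝ),
    IsPLBall k B ∧ P = P' ∪ B ∧ IsPLBall (k - 1) (P' ∩ B)

/-- Polyhedral collapse. -/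
def PolyCollapsesTo (P Q : Set (ℕ → ℝ)) : Prop :=
  Relation.ReflTransGen PolyElemCollapse P Q

/-- Carrier of a subcomplex under a vertex realization map `f`. -/
def subCarrier (f : V → ℕ → ℝ) (L : Finset (Finset V)) : Set (ℕ → ℝ) :=
  ⋃ s ∈ L, convexHull ℝ ((s.image f : Finset (ℕ → ℝ)) : Set (ℕ → ℝ))

/-! ### Bistellar moves. -/

/-- The core `β = {x ∈ A : A \ {x} ∈ X}` of a `(d+2)`-set `A`. -/
def bcore (X : Finset (Finset V)) (A : Finset V) : Finset V :=
  A.filter fun x => A.erase x ∈ X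

/-- `κ_A` is a bistellar `i`-move on the `d`-dimensional complex `X`:
`A` has `d + 2` elements and contains at least one and at most `d + 1` facets
of `X`; with `β` the core of `A` and `α = A \ β` an `i`-face of `X`, one has
`β ∉ X`, and either `α` is a facet of `X` or `Lk_X(α)` has vertex set `β`. -/
def BistellarIMove (d i : ℕ) (X : Finset (Finset V)) (A : Finset V) : Prop :=
  A.card = d + 2 ∧
  0 < ((facets X).filter fun σ => σ ⊆ A).card ∧
  ((facets X).filter fun σ => σ ⊆ A).card ≤ d + 1 ∧
  bcore X A ∉ X ∧
  A \ bcore X A ∈ X ∧ (A \ bcore X A).card = i + 1 ∧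
  (A \ bcore X A ∈ facets X ∨ verts (link X (A \ bcore X A)) = bcore X A)

/-! ### The explicit small complexes of the paper. -/

/-- The complex generated by a list of facets: all nonempty subsets thereof. -/
def genBy (F : Finset (Finset ℕ)) : Finset (Finset ℕ) :=
  F.sup fun s => s.powerset.erase ∅

/-- The standard 2-sphere `S²₄`. -/
def S24 : Finset (Finset ℕ) := stdSphere {1, 2, 3, 4}

/-- The join `S¹₃ * S⁰₂`. -/
def S13S02 : Finset (Finset ℕ) := sjoin (stdSphere {1, 2, 3}) (stdSphere {4, 5})

/-- The octahedron `S⁰₂ * S⁰₂ * S⁰₂`. -/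
def Octa : Finset (Finset ℕ) :=
  sjoin (stdSphere {1, 2}) (sjoin (stdSphere {3, 4}) (stdSphere {5, 6}))

/-- The 6-vertex real projective plane `ℝP²₆`. -/
def RP26 : Finset (Finset ℕ) :=
  genBy {{1, 2, 3}, {1, 2, 4}, {1, 3, 5}, {1, 4, 6}, {1, 5, 6},
         {2, 3, 6}, {2, 4, 5}, {2, 5, 6}, {3, 4, 5}, {3, 4, 6}}

/-- `Σ₁`: the 6-vertex 2-sphere with a vertex of degree 3 and one of degree 5. -/
def Sigma1 : Finset (Finset ℕ) :=
  genBy {{1, 2, 5}, {1, 2, 6}, {1, 5, 6}, {2, 3, 5},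
         {2, 3, 6}, {3, 4, 5}, {3, 4, 6}, {4, 5, 6}}

/-- The double pyramid `S¹₅ * S⁰₂`. -/
def S15S02 : Finset (Finset ℕ) :=
  sjoin (genBy {{1, 2}, {2, 3}, {3, 4}, {4, 5}, {1, 5}}) (stdSphere {6, 7})

/-- `Σ₂` (7-vertex 2-sphere with 10 triangles). -/
def Sigma2 : Finset (Finset ℕ) :=
  genBy {{1, 2, 6}, {1, 2, 7}, {1, 6, 7}, {2, 3, 6}, {2, 3, 7},
         {3, 4, 6}, {3, 4, 7}, {4, 5, 6}, {4, 5, 7}, {5, 6, 7}}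

/-- `Σ₃` (7-vertex 2-sphere with 10 triangles). -/
def Sigma3 : Finset (Finset ℕ) :=
  genBy {{1, 2, 6}, {1, 2, 7}, {1, 6, 7}, {2, 3, 4}, {2, 3, 7},
         {2, 4, 6}, {3, 4, 7}, {4, 5, 6}, {4, 5, 7}, {5, 6, 7}}

/-- `Σ₄` (7-vertex 2-sphere with 10 triangles). -/
def Sigma4 : Finset (Finset ℕ) :=
  genBy {{1, 2, 4}, {1, 2, 7}, {1, 4, 5}, {1, 5, 6}, {1, 6, 7},
         {2, 3, 4}, {2, 3, 7}, {3, 4, 7}, {4, 5, 7}, {5, 6, 7}}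

/-- `Σ₅` (7-vertex 2-sphere with 10 triangles). -/
def Sigma5 : Finset (Finset ℕ) :=
  genBy {{1, 2, 3}, {1, 2, 6}, {1, 3, 5}, {1, 5, 6}, {2, 3, 4},
         {2, 4, 6}, {3, 4, 5}, {4, 5, 7}, {4, 6, 7}, {5, 6, 7}}

/-- `Υ₁ = S²₄ ∪ S²₄`: two tetrahedral spheres sharing exactly one vertex. -/
def Upsilon1 : Finset (Finset ℕ) :=
  stdSphere {1, 2, 3, 7} ∪ stdSphere {4, 5, 6, 7}

/-- `Υ₂ = S²₄ ∪ (S⁰₂ * S¹₃)`: a tetrahedral sphere and a join, where the two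
common vertices span an edge of the `S²₄`. -/
def Upsilon2 : Finset (Finset ℕ) :=
  stdSphere {4, 5, 6, 7} ∪ sjoin (stdSphere {6, 7}) (stdSphere {1, 2, 3})

/-- The complex `R` obtained from `ℝP²₆` by the generalized bistellar 1-move
`κ_A`, `A = {1, 2, 5, 6}` (all such choices of `A` yield isomorphic complexes). -/
def Rcomplex : Finset (Finset ℕ) :=
  genBy {{1, 2, 3}, {1, 2, 4}, {1, 2, 5}, {1, 2, 6}, {1, 3, 5},
         {1, 4, 6}, {2, 3, 6}, {2, 4, 5}, {3, 4, 5}, {3, 4, 6}}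


/-! ### A verified exhaustive search. -/

/-- Triples of labels. -/
abbrev Tri := ℕ × ℕ × ℕ

/-- Sort three labels. -/
def sort3 (a b c : ℕ) : Tri :=
  bif Nat.blt a b then
    bif Nat.blt b c then (a, b, c) else bif Nat.blt a c then (a, c, b) else (c, a, b)
  else
    bif Nat.blt a c then (b, a, c) else bif Nat.blt b c then (b, c, a) else (c, b, a)

/-- `a` is one of the labels of `t`. -/
def hasV (a : ℕ) (t : Tri) : Bool := Nat.beq t.1 a || (Nat.beq t.2.1 a || Nat.beq t.2.2 a)

/-- Both `a` and `b` are labels of `t`. -/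
def hasE (a b : ℕ) (t : Tri) : Bool := hasV a t && hasV b t

/-- Number of triangles of `T` on the edge `ab`. -/
def cnt (T : List Tri) (a b : ℕ) : ℕ := (T.filter (hasE a b)).length

/-- All the edges of the triangles in `T`. -/
def edgesOf (T : List Tri) : List (ℕ × ℕ) :=
  T.flatMap fun t => [(t.1, t.2.1), (t.1, t.2.2), (t.2.1, t.2.2)]

/-- Boolean membership. -/
def memT (t : Tri) (T : List Tri) : Bool :=
  T.any fun u => Nat.beq u.1 t.1 && (Nat.beq u.2.1 t.2.1 && Nat.beq u.2.2 t.2.2)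

/-- Relabel a triple. -/
def mapT (p : List ℕ) (t : Tri) : Tri := sort3 (p.getD t.1 0) (p.getD t.2.1 0) (p.getD t.2.2 0)

/-- The relabelling `p` carries `T` to `F`. -/
def matchT (p : List ℕ) (T F : List Tri) : Bool :=
  T.all (fun t => memT (mapT p t) F) && F.all (fun u => memT u (T.map (mapT p)))

def facetsT1 : List Tri :=
  [(1, 2, 6), (1, 2, 7), (2, 3, 6), (2, 3, 7), (3, 4, 6), (3, 4, 7), (4, 5, 6), (4, 5, 7), (1, 5, 6), (1, 5, 7)]

def permsT1 : List (ℕ × List ℕ) :=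
  [(88360005, [6, 1, 2, 5, 4, 3, 7]),
   (71587140, [1, 2, 6, 7, 5, 4, 3]),
   (71648340, [1, 6, 2, 5, 7, 3, 4])]

def facetsT2 : List Tri :=
  [(1, 2, 6), (1, 2, 7), (1, 6, 7), (2, 3, 6), (2, 3, 7), (3, 4, 6), (3, 4, 7), (4, 5, 6), (4, 5, 7), (5, 6, 7)]

def permsT2 : List (ℕ × List ℕ) :=
  [(70665060, [2, 6, 1, 3, 7, 5, 4]),
   (54813795, [1, 6, 2, 7, 3, 4, 5]),
   (54806070, [6, 1, 7, 2, 3, 4, 5]),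
   (71525955, [1, 2, 6, 7, 5, 4, 3]),
   (71578470, [6, 7, 1, 5, 4, 3, 2]),
   (53888100, [3, 6, 2, 4, 7, 1, 5]),
   (54806115, [1, 6, 7, 2, 3, 4, 5]),
   (54814260, [2, 1, 6, 7, 3, 4, 5]),
   (56837190, [6, 3, 2, 4, 5, 7, 1]),
   (70477380, [2, 3, 6, 7, 1, 5, 4]),
   (104088390, [6, 2, 1, 3, 4, 5, 7]),
   (53765700, [3, 2, 6, 7, 4, 5, 1]),
   (71525430, [6, 1, 2, 7, 5, 4, 3]),
   (70661190, [6, 2, 3, 1, 7, 5, 4]),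
   (54932580, [2, 6, 3, 1, 7, 4, 5])]

def facetsT3 : List Tri :=
  [(1, 2, 6), (1, 2, 7), (1, 6, 7), (2, 3, 4), (2, 3, 7), (2, 4, 6), (3, 4, 7), (4, 5, 6), (4, 5, 7), (5, 6, 7)]

def permsT3 : List (ℕ × List ℕ) :=
  [(53884245, [2, 4, 6, 3, 7, 1, 5]),
   (87372630, [7, 2, 1, 3, 4, 5, 6]),
   (53827125, [2, 1, 7, 6, 4, 3, 5]),
   (53826915, [1, 7, 2, 6, 4, 3, 5]),
   (55793235, [1, 2, 7, 6, 5, 4, 3]),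
   (55797045, [2, 1, 6, 7, 3, 4, 5]),
   (55915365, [2, 7, 1, 3, 4, 6, 5]),
   (55797075, [1, 2, 6, 7, 5, 4, 3]),
   (55792950, [7, 1, 2, 6, 5, 4, 3]),
   (56841045, [2, 4, 3, 6, 1, 7, 5])]

def facetsT4 : List Tri :=
  [(1, 2, 4), (1, 2, 7), (1, 4, 5), (1, 5, 6), (1, 6, 7), (2, 3, 4), (2, 3, 7), (3, 4, 7), (4, 5, 7), (5, 6, 7)]

def permsT4 : List (ℕ × List ℕ) :=
  [(54932805, [1, 5, 4, 6, 7, 2, 3]),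
   (54870885, [1, 7, 6, 2, 4, 5, 3]),
   (56837205, [1, 4, 2, 5, 6, 7, 3]),
   (54940500, [2, 4, 3, 1, 7, 5, 6]),
   (87315510, [7, 3, 2, 4, 5, 6, 1]),
   (56906565, [1, 5, 6, 4, 2, 7, 3]),
   (88298310, [7, 2, 3, 1, 6, 5, 4]),
   (70661460, [2, 4, 1, 3, 7, 6, 5]),
   (54871395, [3, 7, 4, 2, 1, 5, 6]),
   (54748485, [1, 2, 4, 7, 6, 5, 3]),
   (87316035, [3, 2, 7, 4, 5, 6, 1]),
   (54879540, [2, 3, 4, 7, 1, 5, 6]),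
   (53761605, [1, 2, 7, 4, 5, 6, 3]),
   (70599990, [7, 3, 4, 2, 1, 6, 5]),
   (54879315, [3, 4, 2, 7, 1, 5, 6]),
   (70603875, [3, 7, 2, 4, 1, 6, 5]),
   (55850070, [7, 1, 2, 6, 5, 4, 3]),
   (55862325, [1, 6, 5, 7, 2, 4, 3]),
   (55862595, [3, 2, 4, 7, 5, 1, 6]),
   (55850085, [1, 7, 2, 6, 5, 4, 3]),
   (72565590, [7, 1, 6, 2, 3, 4, 5]),
   (54867300, [2, 7, 1, 3, 4, 5, 6]),
   (70604340, [2, 3, 7, 4, 1, 6, 5]),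
   (54748500, [2, 1, 4, 7, 3, 5, 6]),
   (54867270, [7, 2, 1, 3, 4, 5, 6]),
   (54874980, [2, 7, 3, 1, 4, 5, 6]),
   (54871605, [1, 6, 7, 5, 4, 2, 3]),
   (70600275, [3, 4, 7, 2, 1, 6, 5]),
   (54744660, [2, 1, 7, 4, 3, 5, 6]),
   (53888085, [1, 4, 5, 2, 7, 6, 3])]

def facetsT5 : List Tri :=
  [(1, 2, 3), (1, 2, 6), (1, 3, 5), (1, 5, 6), (2, 3, 4), (2, 4, 6), (3, 4, 5), (4, 5, 7), (4, 6, 7), (5, 6, 7)]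

def permsT5 : List (ℕ × List ℕ) :=
  [(55854420, [1, 5, 6, 3, 2, 4, 7]),
   (55858260, [1, 5, 3, 6, 2, 4, 7]),
   (72631125, [4, 5, 7, 3, 2, 6, 1]),
   (71587155, [7, 4, 5, 6, 1, 3, 2]),
   (70600005, [4, 2, 6, 3, 5, 7, 1]),
   (71644245, [4, 5, 3, 7, 6, 2, 1]),
   (72569925, [4, 2, 3, 6, 7, 5, 1]),
   (87377220, [1, 2, 6, 3, 5, 7, 4]),
   (55923780, [1, 2, 3, 6, 5, 4, 7]),
   (71587125, [4, 7, 5, 6, 2, 3, 1])]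

def facetsT6 : List Tri :=
  [(1, 2, 3), (1, 2, 7), (1, 3, 7), (2, 3, 7), (4, 5, 6), (4, 5, 7), (4, 6, 7), (5, 6, 7)]

def permsT6 : List (ℕ × List ℕ) :=
  [(53687859, [1, 2, 7, 3, 4, 5, 6]),
   (53687094, [7, 1, 2, 3, 4, 5, 6]),
   (53687139, [1, 7, 2, 3, 4, 5, 6]),
   (53699379, [1, 2, 3, 7, 4, 5, 6])]

def facetsT7 : List Tri :=
  [(4, 5, 6), (4, 5, 7), (4, 6, 7), (5, 6, 7), (1, 2, 6), (1, 3, 6), (2, 3, 6), (1, 2, 7), (1, 3, 7), (2, 3, 7)]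

def permsT7 : List (ℕ × List ℕ) :=
  [(71590755, [4, 6, 5, 7, 1, 2, 3]),
   (71579235, [4, 6, 7, 5, 1, 2, 3]),
   (71578470, [6, 7, 4, 5, 1, 2, 3]),
   (53888070, [6, 1, 2, 3, 7, 4, 5]),
   (71590710, [6, 4, 5, 7, 1, 2, 3]),
   (71579190, [6, 4, 7, 5, 1, 2, 3]),
   (53765700, [1, 2, 6, 7, 3, 4, 5]),
   (71591475, [4, 5, 6, 7, 1, 2, 3]),
   (53888100, [1, 6, 2, 3, 7, 4, 5])]

/-- The targets, with relabellings that are tried for a given key. -/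
def table : List (List Tri × List (ℕ × List ℕ)) :=
  [(facetsT1, permsT1), (facetsT2, permsT2), (facetsT3, permsT3), (facetsT4, permsT4),
   (facetsT5, permsT5), (facetsT6, permsT6), (facetsT7, permsT7)]

/-- The vertex degrees in `T`, used as a key in order to skip hopeless comparisons. -/
def keyOf (T : List Tri) : ℕ :=
  T.foldr (fun t m => 16 ^ t.1 + 16 ^ t.2.1 + 16 ^ t.2.2 + m) 0

/-- The closed complex `T` is one of the targets. -/
def leaf (T : List Tri) : Bool :=
  table.any fun q => q.2.any fun p => Nat.beq p.1 (keyOf T) && matchT p.2 T q.1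

/-- The search. -/
def check : ℕ → ℕ → List Tri → Bool
  | 0, _, _ => false
  | n + 1, k, T =>
    Nat.blt 10 T.length ||
    ((edgesOf (T.take 1)).any (fun e => Nat.blt 2 (cnt T e.1 e.2)) ||
    match (edgesOf T).find? (fun e => Nat.beq (cnt T e.1 e.2) 1) with
    | some e =>
      (List.range k).all (fun c => Nat.beq c e.1 || (Nat.beq c e.2 ||
        (memT (sort3 e.1 e.2 c) T || check n k (sort3 e.1 e.2 c :: T)))) &&
      (Nat.beq k 7 || check n (k + 1) ((e.1, e.2, k) :: T))
    | none =>
      bif Nat.beq k 7 then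
        leaf T && (Nat.ble 10 T.length ||
          (List.range 7).all fun c => (List.range c).all fun b => (List.range b).all fun a =>
            memT (a, b, c) T || check n 7 ((a, b, c) :: T))
      else
        ((List.range k).all fun y =>
          (List.range y).all (fun z => check n (k + 1) ((z, y, k) :: T)) &&
            (Nat.ble 6 k || check n (k + 2) ((y, k, k + 1) :: T))) &&
        (Nat.ble 5 k || check n (k + 3) ((k, k + 1, k + 2) :: T)))

set_option maxRecDepth 100000 in
theorem check_true : check 20 3 [(0, 1, 2)] = true := by
  decide +kernel

/-! ### Soundness of the search. -/

theorem memT_iff (t : Tri) (T : List Tri) : memT t T = true ↔ t ∈ T := by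
  unfold memT
  rw [List.any_eq_true]
  constructor
  · rintro ⟨u, hu, h⟩
    simp only [Bool.and_eq_true, Nat.beq_eq] at h
    have : u = t := Prod.ext h.1 (Prod.ext h.2.1 h.2.2)
    exact this ▸ hu
  · intro h
    exact ⟨t, h, by simp⟩

theorem hasV_iff (a : ℕ) (t : Tri) : hasV a t = true ↔ (t.1 = a ∨ t.2.1 = a ∨ t.2.2 = a) := by
  simp [hasV]

/-- The image of a triple. -/
def tri {V : Type*} [DecidableEq V] (g : ℕ → V) (t : Tri) : Finset V := {g t.1, g t.2.1, g t.2.2}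

theorem mem_tri {V : Type*} [DecidableEq V] (g : ℕ → V) (t : Tri) (x : V) :
    x ∈ tri g t ↔ (x = g t.1 ∨ x = g t.2.1 ∨ x = g t.2.2) := by
  simp [tri]

theorem tri_sort3 {V : Type*} [DecidableEq V] (g : ℕ → V) (a b c : ℕ) :
    tri g (sort3 a b c) = {g a, g b, g c} := by
  unfold sort3
  cases Nat.blt a b <;> cases Nat.blt b c <;> cases Nat.blt a c <;>
    (ext x; simp [tri]; try tauto)

theorem sort3_sorted (a b c k : ℕ) (hab : a ≠ b) (hac : a ≠ c) (hbc : b ≠ c)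
    (ha : a < k) (hb : b < k) (hc : c < k) :
    (sort3 a b c).1 < (sort3 a b c).2.1 ∧ (sort3 a b c).2.1 < (sort3 a b c).2.2 ∧
      (sort3 a b c).2.2 < k := by
  have key : ∀ x y : ℕ, (Nat.blt x y = true ∧ x < y) ∨ (Nat.blt x y = false ∧ y ≤ x) := by
    intro x y
    rcases lt_or_ge x y with h | h
    · left; exact ⟨by simpa using h, h⟩
    · right; exact ⟨Bool.eq_false_iff.2 (by simpa using h), h⟩
  unfold sort3
  rcases key a b with ⟨e1, h1⟩ | ⟨e1, h1⟩ <;> rcases key b c with ⟨e2, h2⟩ | ⟨e2, h2⟩ <;>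
    rcases key a c with ⟨e3, h3⟩ | ⟨e3, h3⟩ <;> simp only [e1, e2, e3, cond_true, cond_false] <;>
    omega

/-- The basic facts about a 7-vertex weak pseudomanifold with at most ten triangles. -/
structure Setup {V : Type*} [DecidableEq V] (K : Finset (Finset V)) : Prop where
  ne : ∅ ∉ K
  down : ∀ s ∈ K, ∀ t : Finset V, t ⊆ s → t.Nonempty → t ∈ K
  pure : ∀ s ∈ K, ∃ t ∈ K, s ⊆ t ∧ t.card = 3
  deg : ∀ s ∈ K, s.card = 2 → (K.filter fun t => s ⊆ t ∧ t.card = 3).card = 2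
  seven : (verts K).card = 7
  ten : (K.filter fun s => s.card = 3).card ≤ 10

/-- A partial labelling `g` of the vertices by `0, …, k - 1`, with triangles `T` in `K`. -/
structure Inv {V : Type*} [DecidableEq V] (K : Finset (Finset V)) (g : ℕ → V) (k : ℕ)
    (T : List Tri) : Prop where
  inj : ∀ i < k, ∀ j < k, g i = g j → i = j
  mem : ∀ i < k, g i ∈ verts K
  nd : T.Nodup
  srt : ∀ t ∈ T, t.1 < t.2.1 ∧ t.2.1 < t.2.2 ∧ t.2.2 < k
  fac : ∀ t ∈ T, tri g t ∈ K

section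

variable {V : Type*} [DecidableEq V] {K : Finset (Finset V)} {g : ℕ → V} {k : ℕ} {T : List Tri}

theorem mem_verts {x : V} : x ∈ verts K ↔ ∃ s ∈ K, x ∈ s := by
  simp [verts, Finset.mem_sup]

theorem Inv.mem_tri_iff (h : Inv K g k T) {t : Tri} (ht : t.1 < k ∧ t.2.1 < k ∧ t.2.2 < k)
    {a : ℕ} (ha : a < k) : g a ∈ tri g t ↔ (t.1 = a ∨ t.2.1 = a ∨ t.2.2 = a) := by
  rw [mem_tri]
  constructor
  · rintro (e | e | e)
    · exact Or.inl (h.inj _ ha _ ht.1 e).symm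
    · exact Or.inr (Or.inl (h.inj _ ha _ ht.2.1 e).symm)
    · exact Or.inr (Or.inr (h.inj _ ha _ ht.2.2 e).symm)
  · rintro (rfl | rfl | rfl) <;> simp

theorem Inv.tri_inj (h : Inv K g k T) {t u : Tri}
    (ht : t.1 < t.2.1 ∧ t.2.1 < t.2.2 ∧ t.2.2 < k)
    (hu : u.1 < u.2.1 ∧ u.2.1 < u.2.2 ∧ u.2.2 < k) (e : tri g t = tri g u) : t = u := by
  have ht' : t.1 < k ∧ t.2.1 < k ∧ t.2.2 < k := by omega
  have hu' : u.1 < k ∧ u.2.1 < k ∧ u.2.2 < k := by omega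
  have key : ∀ a < k, (t.1 = a ∨ t.2.1 = a ∨ t.2.2 = a) ↔ (u.1 = a ∨ u.2.1 = a ∨ u.2.2 = a) := by
    intro a ha
    rw [← h.mem_tri_iff ht' ha, e, h.mem_tri_iff hu' ha]
  have k1 := (key t.1 ht'.1).1 (by simp)
  have k2 := (key t.2.1 ht'.2.1).1 (by simp)
  have k3 := (key t.2.2 ht'.2.2).1 (by simp)
  refine Prod.ext ?_ (Prod.ext ?_ ?_) <;> omega

theorem Inv.card_tri (h : Inv K g k T) {t : Tri}
    (ht : t.1 < t.2.1 ∧ t.2.1 < t.2.2 ∧ t.2.2 < k) : (tri g t).card = 3 := by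
  unfold tri
  rw [Finset.card_eq_three]
  refine ⟨_, _, _, ?_, ?_, ?_, rfl⟩ <;> intro e
  · have := h.inj _ (by omega) _ (by omega) e
    omega
  · have := h.inj _ (by omega) _ (by omega) e
    omega
  · have := h.inj _ (by omega) _ (by omega) e
    omega

/-- A nodup list of triples has as many images. -/
theorem Inv.card_image (h : Inv K g k T) (S : List Tri) (hS : S.Sublist T) :
    (S.toFinset.image (tri g)).card = S.length := by
  rw [Finset.card_image_of_injOn, List.toFinset_card_of_nodup (h.nd.sublist hS)]
  intro t ht u hu e
  have ht' : t ∈ S := by simpa using ht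
  have hu' : u ∈ S := by simpa using hu
  exact h.tri_inj (h.srt t (hS.subset ht')) (h.srt u (hS.subset hu')) e

theorem Inv.length_le (hK : Setup K) (h : Inv K g k T) : T.length ≤ 10 := by
  rw [← h.card_image T (List.Sublist.refl T)]
  refine le_trans (Finset.card_le_card ?_) hK.ten
  intro s hs
  rw [Finset.mem_image] at hs
  obtain ⟨t, ht, rfl⟩ := hs
  have ht' : t ∈ T := by simpa using ht
  rw [Finset.mem_filter]
  exact ⟨h.fac t ht', h.card_tri (h.srt t ht')⟩

theorem mem_edgesOf {T : List Tri} {e : ℕ × ℕ} (he : e ∈ edgesOf T) :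
    ∃ t ∈ T, e = (t.1, t.2.1) ∨ e = (t.1, t.2.2) ∨ e = (t.2.1, t.2.2) := by
  unfold edgesOf at he
  rw [List.mem_flatMap] at he
  obtain ⟨t, ht, h⟩ := he
  exact ⟨t, ht, by simpa using h⟩

theorem Inv.edge (hK : Setup K) (h : Inv K g k T) {e : ℕ × ℕ} (he : e ∈ edgesOf T) :
    e.1 < e.2 ∧ e.2 < k ∧ ({g e.1, g e.2} : Finset V) ∈ K ∧
      ({g e.1, g e.2} : Finset V).card = 2 := by
  obtain ⟨t, ht, hh⟩ := mem_edgesOf he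
  have hs := h.srt t ht
  have hf := h.fac t ht
  have hlt : e.1 < e.2 ∧ e.2 < k := by
    rcases hh with rfl | rfl | rfl <;> simp only <;> omega
  refine ⟨hlt.1, hlt.2, ?_, ?_⟩
  · apply hK.down _ hf _ _ ⟨g e.1, by simp⟩
    intro x hx
    rw [mem_tri]
    rcases hh with rfl | rfl | rfl <;> simp at hx <;> tauto
  · rw [Finset.card_pair]
    intro e'
    have := h.inj _ (by omega) _ hlt.2 e'
    omega

theorem Inv.subset_tri_iff (h : Inv K g k T) {t : Tri}
    (ht : t.1 < k ∧ t.2.1 < k ∧ t.2.2 < k) {a b : ℕ} (ha : a < k) (hb : b < k) :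
    ({g a, g b} : Finset V) ⊆ tri g t ↔ hasE a b t = true := by
  rw [Finset.insert_subset_iff, Finset.singleton_subset_iff, h.mem_tri_iff ht ha,
    h.mem_tri_iff ht hb, hasE, Bool.and_eq_true, hasV_iff, hasV_iff]

theorem Inv.cnt_le (hK : Setup K) (h : Inv K g k T) {e : ℕ × ℕ} (he : e ∈ edgesOf T) :
    cnt T e.1 e.2 ≤ 2 := by
  obtain ⟨h1, h2, h3, h4⟩ := h.edge hK he
  unfold cnt
  rw [← hK.deg _ h3 h4, ← h.card_image _ List.filter_sublist]
  apply Finset.card_le_card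
  intro s hs
  rw [Finset.mem_image] at hs
  obtain ⟨t, ht, rfl⟩ := hs
  rw [List.mem_toFinset, List.mem_filter] at ht
  have hs := h.srt t ht.1
  rw [Finset.mem_filter, h.subset_tri_iff (by omega) (by omega) h2]
  exact ⟨h.fac t ht.1, ht.2, h.card_tri hs⟩

/-- An edge in just one triangle of `T` lies in a further triangle of `K`. -/
theorem Inv.open_edge (hK : Setup K) (h : Inv K g k T) {e : ℕ × ℕ} (he : e ∈ edgesOf T)
    (hc : cnt T e.1 e.2 = 1) :
    ∃ x ∈ verts K, x ≠ g e.1 ∧ x ≠ g e.2 ∧ ({g e.1, g e.2, x} : Finset V) ∈ K ∧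
      ∀ t ∈ T, tri g t ≠ {g e.1, g e.2, x} := by
  obtain ⟨h1, h2, h3, h4⟩ := h.edge hK he
  by_contra hno
  push Not at hno
  have hle : (K.filter fun t => ({g e.1, g e.2} : Finset V) ⊆ t ∧ t.card = 3) ⊆
      (T.filter (hasE e.1 e.2)).toFinset.image (tri g) := by
    intro s hs
    rw [Finset.mem_filter] at hs
    obtain ⟨hsK, hsub, hcard⟩ := hs
    have : (s \ {g e.1, g e.2}).card = 1 := by
      rw [Finset.card_sdiff_of_subset hsub, hcard, h4]
    obtain ⟨x, hx⟩ := Finset.card_eq_one.1 this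
    have hxs : x ∈ s \ {g e.1, g e.2} := by rw [hx]; simp
    rw [Finset.mem_sdiff] at hxs
    have hs' : s = {g e.1, g e.2, x} := by
      rw [← Finset.sdiff_union_of_subset hsub, hx]
      ext y
      simp
      tauto
    have hx2 : x ≠ g e.1 ∧ x ≠ g e.2 := by
      have := hxs.2
      simp at this
      tauto
    obtain ⟨t, ht, hte⟩ := hno x (mem_verts.2 ⟨s, hsK, hxs.1⟩) hx2.1 hx2.2 (hs' ▸ hsK)
    rw [Finset.mem_image]
    refine ⟨t, ?_, by rw [hte, hs']⟩
    rw [List.mem_toFinset, List.mem_filter]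
    refine ⟨ht, ?_⟩
    have hs := h.srt t ht
    rw [← h.subset_tri_iff (by omega) (by omega) h2, hte, ← hs']
    exact hsub
  have := Finset.card_le_card hle
  rw [hK.deg _ h3 h4, h.card_image _ List.filter_sublist] at this
  unfold cnt at hc
  omega

theorem Inv.cons (h : Inv K g k T) {t : Tri}
    (ht : t.1 < t.2.1 ∧ t.2.1 < t.2.2 ∧ t.2.2 < k) (hK : tri g t ∈ K) (hm : t ∉ T) :
    Inv K g k (t :: T) where
  inj := h.inj
  mem := h.mem
  nd := List.nodup_cons.2 ⟨hm, h.nd⟩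
  srt := by
    intro u hu
    rcases List.mem_cons.1 hu with rfl | hu
    · exact ht
    · exact h.srt u hu
  fac := by
    intro u hu
    rcases List.mem_cons.1 hu with rfl | hu
    · exact hK
    · exact h.fac u hu

theorem Inv.card_range (h : Inv K g k T) : ((Finset.range k).image g).card = k := by
  rw [Finset.card_image_of_injOn, Finset.card_range]
  intro i hi j hj e
  exact h.inj i (by simpa using hi) j (by simpa using hj) e

theorem Inv.range_subset (h : Inv K g k T) : (Finset.range k).image g ⊆ verts K := by
  intro x hx
  rw [Finset.mem_image] at hx
  obtain ⟨i, hi, rfl⟩ := hx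
  exact h.mem i (by simpa using hi)

theorem Inv.le_seven (hK : Setup K) (h : Inv K g k T) : k ≤ 7 := by
  rw [← h.card_range, ← hK.seven]
  exact Finset.card_le_card h.range_subset

theorem Inv.surj (hK : Setup K) (h : Inv K g 7 T) {x : V} (hx : x ∈ verts K) :
    ∃ i < 7, g i = x := by
  have := Finset.eq_of_subset_of_card_le h.range_subset (by rw [h.card_range, hK.seven])
  rw [← this, Finset.mem_image] at hx
  obtain ⟨i, hi, e⟩ := hx
  exact ⟨i, by simpa using hi, e⟩

theorem Inv.exists_new (hK : Setup K) (h : Inv K g k T) (hk : k < 7) :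
    ∃ x ∈ verts K, ∀ i < k, g i ≠ x := by
  by_contra hno
  push Not at hno
  have : (verts K).card ≤ ((Finset.range k).image g).card := by
    apply Finset.card_le_card
    intro x hx
    obtain ⟨i, hi, e⟩ := hno x hx
    exact Finset.mem_image.2 ⟨i, by simpa using hi, e⟩
  rw [h.card_range, hK.seven] at this
  omega

theorem tri_congr {g g' : ℕ → V} {t : Tri} (h1 : g' t.1 = g t.1) (h2 : g' t.2.1 = g t.2.1)
    (h3 : g' t.2.2 = g t.2.2) : tri g' t = tri g t := by
  unfold tri
  rw [h1, h2, h3]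

/-- Label a new vertex by `k`. -/
theorem Inv.extend (h : Inv K g k T) {x : V} (hx : x ∈ verts K) (hn : ∀ i < k, g i ≠ x) :
    ∃ g' : ℕ → V, Inv K g' (k + 1) T ∧ g' k = x ∧ ∀ i < k, g' i = g i := by
  refine ⟨Function.update g k x, ?_, by simp, ?_⟩
  swap
  · intro i hi
    exact Function.update_of_ne (by omega) _ _
  have hlt : ∀ i < k, Function.update g k x i = g i := fun i hi =>
    Function.update_of_ne (by omega) _ _
  have hk : Function.update g k x k = x := by simp
  constructor
  · intro i hi j hj e
    rcases Nat.lt_succ_iff_lt_or_eq.1 hi with hi | rfl <;>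
      rcases Nat.lt_succ_iff_lt_or_eq.1 hj with hj | rfl
    · rw [hlt i hi, hlt j hj] at e
      exact h.inj i hi j hj e
    · rw [hlt i hi, hk] at e
      exact absurd e (hn i hi)
    · rw [hlt j hj, hk] at e
      exact absurd e.symm (hn j hj)
    · rfl
  · intro i hi
    rcases Nat.lt_succ_iff_lt_or_eq.1 hi with hi | rfl
    · rw [hlt i hi]
      exact h.mem i hi
    · rw [hk]
      exact hx
  · exact h.nd
  · intro t ht
    have := h.srt t ht
    omega
  · intro t ht
    have := h.srt t ht
    rw [tri_congr (g := g) (hlt _ (by omega)) (hlt _ (by omega)) (hlt _ (by omega))]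
    exact h.fac t ht

theorem Inv.notMem_of_ge (h : Inv K g k T) {t : Tri} (ht : k ≤ t.2.2) : t ∉ T := by
  intro hm
  have := h.srt t hm
  omega

end

/-- `L` is the complex with facet list `F`. -/
def GenList (L : Finset (Finset ℕ)) (F : List Tri) : Prop :=
  ∀ s, s ∈ L ↔ s.Nonempty ∧ ∃ u ∈ F, s ⊆ tri id u

theorem genList_genBy (F : List Tri) : GenList (genBy (F.toFinset.image (tri id))) F := by
  intro s
  simp only [genBy, Finset.mem_sup, Finset.mem_erase, Finset.mem_powerset, Finset.mem_image,
    List.mem_toFinset, exists_exists_and_eq_and, Finset.nonempty_iff_ne_empty]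
  constructor
  · rintro ⟨u, hu, hne, hsub⟩
    exact ⟨hne, u, hu, hsub⟩
  · rintro ⟨hne, u, hu, hsub⟩
    exact ⟨u, hu, hne, hsub⟩

theorem gen1 : GenList S15S02 facetsT1 := by
  have : S15S02 = genBy (facetsT1.toFinset.image (tri id)) := by
    unfold S15S02 sjoin stdSphere genBy
    decide +kernel
  exact this ▸ genList_genBy _

theorem gen2 : GenList Sigma2 facetsT2 := by
  have : Sigma2 = genBy (facetsT2.toFinset.image (tri id)) := by
    unfold Sigma2 genBy
    decide +kernel
  exact this ▸ genList_genBy _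

theorem gen3 : GenList Sigma3 facetsT3 := by
  have : Sigma3 = genBy (facetsT3.toFinset.image (tri id)) := by
    unfold Sigma3 genBy
    decide +kernel
  exact this ▸ genList_genBy _

theorem gen4 : GenList Sigma4 facetsT4 := by
  have : Sigma4 = genBy (facetsT4.toFinset.image (tri id)) := by
    unfold Sigma4 genBy
    decide +kernel
  exact this ▸ genList_genBy _

theorem gen5 : GenList Sigma5 facetsT5 := by
  have : Sigma5 = genBy (facetsT5.toFinset.image (tri id)) := by
    unfold Sigma5 genBy
    decide +kernel
  exact this ▸ genList_genBy _

theorem gen6 : GenList Upsilon1 facetsT6 := by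
  have : Upsilon1 = genBy (facetsT6.toFinset.image (tri id)) := by
    unfold Upsilon1 stdSphere genBy
    decide +kernel
  exact this ▸ genList_genBy _

theorem gen7 : GenList Upsilon2 facetsT7 := by
  have : Upsilon2 = genBy (facetsT7.toFinset.image (tri id)) := by
    unfold Upsilon2 sjoin stdSphere genBy
    decide +kernel
  exact this ▸ genList_genBy _

/-- `p` has pairwise distinct entries. -/
def permOK (p : List ℕ) : Bool :=
  (List.range 7).all fun i => (List.range i).all fun j => !(Nat.beq (p.getD i 0) (p.getD j 0))

theorem table_ok : (table.all fun q => q.2.all fun p => permOK p.2) = true := by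
  decide +kernel

theorem permOK_inj {p : List ℕ} (h : permOK p = true) :
    ∀ i < 7, ∀ j < 7, p.getD i 0 = p.getD j 0 → i = j := by
  have key : ∀ i < 7, ∀ j < i, p.getD i 0 ≠ p.getD j 0 := by
    intro i hi j hj e
    unfold permOK at h
    rw [List.all_eq_true] at h
    have h1 := h i (List.mem_range.2 hi)
    rw [List.all_eq_true] at h1
    have h2 := h1 j (List.mem_range.2 hj)
    rw [e] at h2
    simp at h2
  intro i hi j hj e
  rcases lt_trichotomy i j with hl | hl | hl
  · exact absurd e.symm (key j hj i hl)
  · exact hl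
  · exact absurd e (key i hi j hl)

section

variable {V : Type*} [DecidableEq V] {K : Finset (Finset V)} {g : ℕ → V} {k : ℕ} {T : List Tri}

/-- A matching relabelling yields an isomorphism. -/
theorem iso_of_match (hK : Setup K) (h : Inv K g 7 T)
    (hall : ∀ s ∈ K, s.card = 3 → ∃ t ∈ T, tri g t = s) {p : List ℕ} {F : List Tri}
    (hp : permOK p = true) (hm : matchT p T F = true) {L : Finset (Finset ℕ)}
    (hL : GenList L F) : Iso K L := by
  classical
  have hp' := permOK_inj hp
  obtain ⟨f, hf⟩ : ∃ f : V → ℕ, ∀ i < 7, f (g i) = p.getD i 0 := by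
    refine ⟨fun x => if hx : ∃ i, i < 7 ∧ g i = x then p.getD hx.choose 0 else 0, ?_⟩
    intro i hi
    have hx : ∃ j, j < 7 ∧ g j = g i := ⟨i, hi, rfl⟩
    simp only [dif_pos hx]
    rw [h.inj _ hx.choose_spec.1 _ hi hx.choose_spec.2]
  have himg : ∀ t ∈ T, tri id (mapT p t) = (tri g t).image f := by
    intro t ht
    have hs := h.srt t ht
    unfold mapT
    rw [tri_sort3]
    unfold tri
    rw [Finset.image_insert, Finset.image_insert, Finset.image_singleton, hf _ (by omega),
      hf _ (by omega), hf _ (by omega)]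
    rfl
  unfold matchT at hm
  rw [Bool.and_eq_true, List.all_eq_true, List.all_eq_true] at hm
  obtain ⟨hm1, hm2⟩ := hm
  refine ⟨f, ?_, ?_⟩
  · intro x hx y hy e
    obtain ⟨i, hi, rfl⟩ := h.surj hK (by simpa using hx)
    obtain ⟨j, hj, rfl⟩ := h.surj hK (by simpa using hy)
    rw [hf i hi, hf j hj] at e
    rw [hp' i hi j hj e]
  · ext s
    rw [hL s, Finset.mem_image]
    constructor
    · rintro ⟨hne, u, hu, hsub⟩
      have hu2 := hm2 u hu
      rw [memT_iff, List.mem_map] at hu2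
      obtain ⟨t, ht, rfl⟩ := hu2
      rw [himg t ht, Finset.subset_image_iff] at hsub
      obtain ⟨s', hs', rfl⟩ := hsub
      exact ⟨s', hK.down _ (h.fac t ht) s' hs' (Finset.image_nonempty.1 hne), rfl⟩
    · rintro ⟨s', hs', rfl⟩
      obtain ⟨r, hr, hsr, hc⟩ := hK.pure s' hs'
      obtain ⟨t, ht, rfl⟩ := hall r hr hc
      refine ⟨?_, mapT p t, (memT_iff _ _).1 (hm1 t ht), ?_⟩
      · rw [Finset.image_nonempty, Finset.nonempty_iff_ne_empty]
        rintro rfl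
        exact hK.ne hs'
      · rw [himg t ht]
        exact Finset.image_subset_image hsr

/-- The conclusion of the theorem. -/
def Concl (K : Finset (Finset V)) : Prop :=
  Iso K S15S02 ∨ Iso K Sigma2 ∨ Iso K Sigma3 ∨ Iso K Sigma4 ∨
      Iso K Sigma5 ∨ Iso K Upsilon1 ∨ Iso K Upsilon2

theorem concl_of_leaf (hK : Setup K) (h : Inv K g 7 T)
    (hall : ∀ s ∈ K, s.card = 3 → ∃ t ∈ T, tri g t = s) (hl : leaf T = true) : Concl K := by
  unfold leaf at hl
  rw [List.any_eq_true] at hl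
  obtain ⟨q, hq, hl⟩ := hl
  rw [List.any_eq_true] at hl
  obtain ⟨p, hp, hl⟩ := hl
  have hl := (Bool.and_eq_true _ _ ▸ hl : _ ∧ _).2
  have hok := table_ok
  rw [List.all_eq_true] at hok
  have hok1 := hok q hq
  rw [List.all_eq_true] at hok1
  have hok2 := hok1 p hp
  have key : ∀ L : Finset (Finset ℕ), GenList L q.1 → Iso K L := fun L hL =>
    iso_of_match hK h hall hok2 hl hL
  unfold table at hq
  simp only [List.mem_cons, List.not_mem_nil, or_false] at hq
  unfold Concl
  rcases hq with rfl | rfl | rfl | rfl | rfl | rfl | rfl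
  · exact Or.inl (key _ gen1)
  · exact Or.inr (Or.inl (key _ gen2))
  · exact Or.inr (Or.inr (Or.inl (key _ gen3)))
  · exact Or.inr (Or.inr (Or.inr (Or.inl (key _ gen4))))
  · exact Or.inr (Or.inr (Or.inr (Or.inr (Or.inl (key _ gen5)))))
  · exact Or.inr (Or.inr (Or.inr (Or.inr (Or.inr (Or.inl (key _ gen6))))))
  · exact Or.inr (Or.inr (Or.inr (Or.inr (Or.inr (Or.inr (key _ gen7))))))

/-- Ten triangles are all of them. -/
theorem Inv.all_of_ten (hK : Setup K) (h : Inv K g k T) (hT : 10 ≤ T.length) :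
    ∀ s ∈ K, s.card = 3 → ∃ t ∈ T, tri g t = s := by
  intro s hs hc
  have hsub : T.toFinset.image (tri g) ⊆ K.filter fun s => s.card = 3 := by
    intro r hr
    rw [Finset.mem_image] at hr
    obtain ⟨t, ht, rfl⟩ := hr
    rw [List.mem_toFinset] at ht
    rw [Finset.mem_filter]
    exact ⟨h.fac t ht, h.card_tri (h.srt t ht)⟩
  have heq := Finset.eq_of_subset_of_card_le hsub (by
    rw [h.card_image T (List.Sublist.refl T)]
    exact le_trans hK.ten hT)
  have hm : s ∈ K.filter fun s => s.card = 3 := Finset.mem_filter.2 ⟨hs, hc⟩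
  rw [← heq, Finset.mem_image] at hm
  obtain ⟨t, ht, e⟩ := hm
  exact ⟨t, by simpa using ht, e⟩

theorem check_sound (hK : Setup K) : ∀ (n k : ℕ) (T : List Tri) (g : ℕ → V),
    Inv K g k T → check n k T = true → Concl K := by
  intro n
  induction n with
  | zero =>
    intro k T g _ hc
    simp [check] at hc
  | succ n ih =>
    intro k T g h hc
    unfold check at hc
    rw [Bool.or_eq_true, Bool.or_eq_true] at hc
    rcases hc with hc | hc | hc
    · have := h.length_le hK
      simp at hc
      omega
    · exfalso
      rw [List.any_eq_true] at hc
      obtain ⟨e, he, hc⟩ := hc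
      have he' : e ∈ edgesOf T := by
        unfold edgesOf at he ⊢
        rw [List.mem_flatMap] at he ⊢
        obtain ⟨t, ht, he⟩ := he
        exact ⟨t, List.mem_of_mem_take ht, he⟩
      have := h.cnt_le hK he'
      simp at hc
      omega
    · split at hc
      · rename_i e hfind
        have he : e ∈ edgesOf T := List.mem_of_find?_eq_some hfind
        have hcnt : cnt T e.1 e.2 = 1 := by
          have := List.find?_some hfind
          simpa using this
        obtain ⟨x, hx, hx1, hx2, hxK, hxT⟩ := h.open_edge hK he hcnt
        obtain ⟨e1, e2, -, -⟩ := h.edge hK he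
        rw [Bool.and_eq_true, List.all_eq_true] at hc
        obtain ⟨hc1, hc2⟩ := hc
        by_cases hnew : ∀ i < k, g i ≠ x
        · obtain ⟨g', h', hg', hg⟩ := h.extend hx hnew
          have h7 := h'.le_seven hK
          rw [Bool.or_eq_true] at hc2
          rcases hc2 with hc2 | hc2
          · simp at hc2
            omega
          · refine ih _ _ g' (h'.cons ⟨e1, e2, by simp⟩ ?_ (h.notMem_of_ge (by simp))) hc2
            have : tri g' (e.1, e.2, k) = {g e.1, g e.2, x} := by
              unfold tri
              simp only
              rw [hg', hg _ (by omega), hg _ (by omega)]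
            rw [this]
            exact hxK
        · push Not at hnew
          obtain ⟨c, hck, rfl⟩ := hnew
          have hc3 := hc1 c (List.mem_range.2 hck)
          rw [Bool.or_eq_true, Bool.or_eq_true, Bool.or_eq_true] at hc3
          have n1 : c ≠ e.1 := fun e' => hx1 (by rw [e'])
          have n2 : c ≠ e.2 := fun e' => hx2 (by rw [e'])
          rcases hc3 with hc3 | hc3 | hc3 | hc3
          · exact absurd (by simpa using hc3) n1
          · exact absurd (by simpa using hc3) n2
          · rw [memT_iff] at hc3
            exact absurd (tri_sort3 g _ _ _) (hxT _ hc3)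
          · refine ih _ _ g (h.cons ?_ ?_ ?_) hc3
            · exact sort3_sorted _ _ _ _ (by omega) (by omega) (by omega) (by omega) e2 hck
            · rw [tri_sort3]
              exact hxK
            · intro hm
              exact hxT _ hm (tri_sort3 g _ _ _)
      · by_cases hk : k = 7
        · subst hk
          simp only [Nat.beq_refl, cond_true] at hc
          rw [Bool.and_eq_true] at hc
          obtain ⟨hl, hc⟩ := hc
          by_cases hall : ∀ s ∈ K, s.card = 3 → ∃ t ∈ T, tri g t = s
          · exact concl_of_leaf hK h hall hl
          · rw [Bool.or_eq_true] at hc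
            rcases hc with hc | hc
            · exact absurd (h.all_of_ten hK (by simpa using hc)) hall
            · push Not at hall
              obtain ⟨s, hs, hcard, hsT⟩ := hall
              obtain ⟨x, y, z, hxy, hxz, hyz, rfl⟩ := Finset.card_eq_three.1 hcard
              obtain ⟨i, hi, rfl⟩ := h.surj hK (mem_verts.2 ⟨_, hs, by simp⟩ : x ∈ verts K)
              obtain ⟨j, hj, rfl⟩ := h.surj hK (mem_verts.2 ⟨_, hs, by simp⟩ : y ∈ verts K)
              obtain ⟨l, hl', rfl⟩ := h.surj hK (mem_verts.2 ⟨_, hs, by simp⟩ : z ∈ verts K)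
              have hso := sort3_sorted i j l 7 (fun e => hxy (by rw [e]))
                (fun e => hxz (by rw [e])) (fun e => hyz (by rw [e])) hi hj hl'
              have htri := tri_sort3 g i j l
              have hmem : sort3 i j l ∉ T := fun hm => hsT _ hm htri
              rw [List.all_eq_true] at hc
              have hc := hc _ (List.mem_range.2 hso.2.2)
              rw [List.all_eq_true] at hc
              have hc := hc _ (List.mem_range.2 hso.2.1)
              rw [List.all_eq_true] at hc
              have hc := hc _ (List.mem_range.2 hso.1)
              rw [Bool.or_eq_true, memT_iff] at hc
              rcases hc with hc | hc
              · exact absurd hc hmem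
              · refine ih _ _ g (h.cons hso ?_ hmem) hc
                rw [htri]
                exact hs
        · have hk7 : k < 7 := lt_of_le_of_ne (h.le_seven hK) hk
          have hb : Nat.beq k 7 = false := Bool.eq_false_iff.2 (by simpa using hk)
          rw [hb, cond_false, Bool.and_eq_true, List.all_eq_true] at hc
          obtain ⟨hc1, hc2⟩ := hc
          obtain ⟨x, hx, hxn⟩ := h.exists_new hK hk7
          obtain ⟨g1, h1, hg1, hgg1⟩ := h.extend hx hxn
          obtain ⟨s0, hs0, hxs0⟩ := mem_verts.1 hx
          obtain ⟨s, hs, hsub, hcard⟩ := hK.pure s0 hs0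
          have hxs : x ∈ s := hsub hxs0
          have hcard2 : (s.erase x).card = 2 := by rw [Finset.card_erase_of_mem hxs, hcard]
          obtain ⟨y, z, hyz, hs2⟩ := Finset.card_eq_two.1 hcard2
          have hsxyz : s = {x, y, z} := by rw [← Finset.insert_erase hxs, hs2]
          have hy : y ∈ s.erase x := by rw [hs2]; simp
          have hz : z ∈ s.erase x := by rw [hs2]; simp
          rw [Finset.mem_erase] at hy hz
          have hyv : y ∈ verts K := mem_verts.2 ⟨s, hs, hy.2⟩
          have hzv : z ∈ verts K := mem_verts.2 ⟨s, hs, hz.2⟩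
          -- one old neighbour and one new one
          have mixed : ∀ i < k, ∀ w ∈ verts K, w ≠ x → (∀ j < k, g j ≠ w) →
              s = {x, g i, w} → Concl K := by
            intro i hi w hw hwx hwn hsw
            obtain ⟨g2, h2, hg2, hgg2⟩ := h1.extend hw (by
              intro j hj
              rcases Nat.lt_succ_iff_lt_or_eq.1 hj with hj | rfl
              · rw [hgg1 j hj]
                exact hwn j hj
              · rw [hg1]
                exact hwx.symm)
            have h7 := h2.le_seven hK
            have hc3 := hc1 i (List.mem_range.2 hi)
            rw [Bool.and_eq_true, Bool.or_eq_true] at hc3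
            rcases hc3.2 with hc4 | hc4
            · simp at hc4
              omega
            · refine ih _ _ g2 (h2.cons ⟨hi, by simp, by simp⟩ ?_ (h.notMem_of_ge (by simp))) hc4
              have : tri g2 (i, k, k + 1) = s := by
                rw [hsw]
                unfold tri
                simp only
                rw [hg2, hgg2 _ (by omega), hgg2 _ (by omega), hg1, hgg1 _ hi]
                ext v
                simp
                tauto
              rw [this]
              exact hs
          -- two old neighbours
          have old : ∀ i < k, ∀ j < i, s = {x, g i, g j} → Concl K := by
            intro i hi j hj hsw
            have hc3 := hc1 i (List.mem_range.2 hi)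
            rw [Bool.and_eq_true, List.all_eq_true] at hc3
            have hc4 := hc3.1 j (List.mem_range.2 hj)
            refine ih _ _ g1 (h1.cons ⟨hj, hi, by simp⟩ ?_ (h.notMem_of_ge (by simp))) hc4
            have : tri g1 (j, i, k) = s := by
              rw [hsw]
              unfold tri
              simp only
              rw [hg1, hgg1 _ hi, hgg1 _ (by omega)]
              ext v
              simp
              tauto
            rw [this]
            exact hs
          by_cases hyn : ∀ i < k, g i ≠ y
          · by_cases hzn : ∀ i < k, g i ≠ z
            · obtain ⟨g2, h2, hg2, hgg2⟩ := h1.extend hyv (by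
                intro j hj
                rcases Nat.lt_succ_iff_lt_or_eq.1 hj with hj | rfl
                · rw [hgg1 j hj]
                  exact hyn j hj
                · rw [hg1]
                  exact hy.1.symm)
              obtain ⟨g3, h3, hg3, hgg3⟩ := h2.extend hzv (by
                intro j hj
                rcases Nat.lt_succ_iff_lt_or_eq.1 hj with hj | rfl
                · rw [hgg2 j hj]
                  rcases Nat.lt_succ_iff_lt_or_eq.1 hj with hj | rfl
                  · rw [hgg1 j hj]
                    exact hzn j hj
                  · rw [hg1]
                    exact hz.1.symm
                · rw [hg2]
                  exact hyz)
              have h7 := h3.le_seven hK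
              rw [Bool.or_eq_true] at hc2
              rcases hc2 with hc4 | hc4
              · simp at hc4
                omega
              · refine ih _ _ g3 (h3.cons ⟨by simp, by simp, by simp⟩ ?_
                  (h.notMem_of_ge (by simp))) hc4
                have : tri g3 (k, k + 1, k + 2) = s := by
                  rw [hsxyz]
                  unfold tri
                  simp only
                  rw [hg3, hgg3 _ (by omega), hgg3 _ (by omega), hg2, hgg2 _ (by omega), hg1]
                rw [this]
                exact hs
            · push Not at hzn
              obtain ⟨i, hi, rfl⟩ := hzn
              refine mixed i hi y hyv hy.1 hyn ?_
              rw [hsxyz, Finset.pair_comm]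
          · push Not at hyn
            obtain ⟨i, hi, rfl⟩ := hyn
            by_cases hzn : ∀ i < k, g i ≠ z
            · exact mixed i hi z hzv hz.1 hzn hsxyz
            · push Not at hzn
              obtain ⟨j, hj, rfl⟩ := hzn
              rcases lt_trichotomy i j with hl | hl | hl
              · refine old j hj i hl ?_
                rw [hsxyz, Finset.pair_comm]
              · exact absurd (by rw [hl]) hyz
              · exact old i hi j hl hsxyz

theorem setup_of (hw : IsWeakPseudomanifold 2 K) (h7 : (verts K).card = 7)
    (hfac : (K.filter fun s => s.card = 3).card ≤ 10) : Setup K where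
  ne := hw.1.2.1
  down := hw.1.2.2
  pure := by
    intro s hs
    obtain ⟨t, ht, hmax⟩ := (K.filter fun t => s ⊆ t).exists_max_image Finset.card
      ⟨s, Finset.mem_filter.2 ⟨hs, Finset.Subset.refl s⟩⟩
    rw [Finset.mem_filter] at ht
    refine ⟨t, ht.1, ht.2, hw.2.1 t ?_⟩
    unfold facets
    rw [Finset.mem_filter]
    refine ⟨ht.1, fun u hu htu => ?_⟩
    exact (Finset.eq_of_subset_of_card_le htu
      (hmax u (Finset.mem_filter.2 ⟨hu, ht.2.trans htu⟩))).symm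
  deg := by
    intro s hs hc
    have := hw.2.2 s hs hc
    unfold degOf at this
    convert this
  seven := h7
  ten := hfac

theorem concl_of_setup (hK : Setup K) : Concl K := by
  have hne : (verts K).Nonempty := by
    rw [← Finset.card_pos, hK.seven]
    norm_num
  obtain ⟨v, hv⟩ := hne
  obtain ⟨s0, hs0, -⟩ := mem_verts.1 hv
  obtain ⟨s, hs, -, hcard⟩ := hK.pure s0 hs0
  obtain ⟨x, y, z, hxy, hxz, hyz, rfl⟩ := Finset.card_eq_three.1 hcard
  have hx : x ∈ verts K := mem_verts.2 ⟨_, hs, by simp⟩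
  have hy : y ∈ verts K := mem_verts.2 ⟨_, hs, by simp⟩
  have hz : z ∈ verts K := mem_verts.2 ⟨_, hs, by simp⟩
  have h0 : Inv K (fun _ => x) 0 [] :=
    ⟨by simp, by simp, by simp, by simp, by simp⟩
  obtain ⟨g1, h1, e1, -⟩ := h0.extend hx (by simp)
  obtain ⟨g2, h2, e2, f2⟩ := h1.extend hy (by
    intro i hi
    obtain rfl : i = 0 := by omega
    rw [e1]
    exact hxy)
  obtain ⟨g3, h3, e3, f3⟩ := h2.extend hz (by
    intro i hi
    obtain rfl | rfl : i = 0 ∨ i = 1 := by omega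
    · rw [f2 0 (by omega), e1]
      exact hxz
    · have := e2
      simp only [Nat.zero_add] at this
      rw [this]
      exact hyz)
  refine check_sound hK 20 3 [(0, 1, 2)] g3 (h3.cons (by simp) ?_ (by simp)) check_true
  have : tri g3 (0, 1, 2) = {x, y, z} := by
    simp only [Nat.zero_add] at e1 e2 e3
    unfold tri
    simp only
    rw [f3 0 (by omega), f3 1 (by omega), f2 0 (by omega), e1, e2]
    have e3' : g3 2 = z := e3
    rw [e3']
  rw [this]
  exact hs

end

/-- Proposition 2: every 7-vertex 2-dimensional weak
pseudomanifold with at most 10 facets is isomorphic to `S¹₅ * S⁰₂`,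
`Σ₂, …, Σ₅`, `Υ₁` or `Υ₂`. -/
theorem seven_vertex_weak_pseudomanifolds {V : Type*} [DecidableEq V]
    (K : Finset (Finset V))
    (hw : IsWeakPseudomanifold 2 K) (h7 : (verts K).card = 7)
    (hfac : (K.filter fun s => s.card = 3).card ≤ 10) :
    Iso K S15S02 ∨ Iso K Sigma2 ∨ Iso K Sigma3 ∨ Iso K Sigma4 ∨
      Iso K Sigma5 ∨ Iso K Upsilon1 ∨ Iso K Upsilon2 := by
  exact concl_of_setup (setup_of hw h7 hfac)

end HomologySpheres
end
end

section
/- Every 7-vertex 2-dimensional Z₂-acyclic simplicial complex is collapsible. -/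
/- Formalization of definitions from:
   B. Bagchi, B. Datta, "Combinatorial triangulations of homology spheres". -/

open Finset

noncomputable section

attribute [local instance] Classical.propDecidable

namespace HomologySpheres

variable {V : Type*} [DecidableEq V] {W : Type*} [DecidableEq W]

/-! ### Proof of the theorem -/

/-- Boundary with respect to a family `P`. -/
def bdP (P : Finset (Finset V)) (c : Finset V → ZMod 2) (t : Finset V) : ZMod 2 :=
  ∑ s ∈ P.filter (fun s => t ⊆ s), c s

theorem z2bdry_eq_bdP (K P : Finset (Finset V)) (n : ℕ) (hPK : P ⊆ K)
    (hP : ∀ s ∈ P, s.card = n + 1) (c : Finset V → ZMod 2) (hc : ∀ s, c s ≠ 0 → s ∈ P)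
    (t : Finset V) (ht : t.card = n) : z2bdry K c t = bdP P c t := by
  unfold z2bdry bdP
  refine Finset.sum_bij_ne_zero (fun v _ _ => insert v t) ?_ ?_ ?_ ?_
  · intro v hv h0
    simp only [Finset.mem_filter]
    exact ⟨hc _ h0, Finset.subset_insert _ _⟩
  · intro v hv _ w hw _ h
    have hv' : v ∈ insert w t := h ▸ Finset.mem_insert_self v t
    rcases Finset.mem_insert.1 hv' with h1 | h1
    · exact h1
    · exact absurd h1 (Finset.mem_sdiff.1 hv).2
  · intro s hs h0
    obtain ⟨hsP, hts⟩ := Finset.mem_filter.1 hs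
    have hcard : (s \ t).card = 1 := by
      rw [Finset.card_sdiff_of_subset hts, hP s hsP, ht]; omega
    obtain ⟨v, hv⟩ := Finset.card_eq_one.1 hcard
    have hvs : v ∈ s \ t := by rw [hv]; simp
    have hins : insert v t = s := by
      rw [Finset.insert_eq, ← hv, Finset.sdiff_union_of_subset hts]
    refine ⟨v, ?_, by rw [hins]; exact h0, hins⟩
    rw [Finset.mem_sdiff] at hvs ⊢
    refine ⟨?_, hvs.2⟩
    exact (Finset.le_sup (f := id) (hPK hsP) : s ≤ K.sup id) hvs.1
  · intro v _ _; rfl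

theorem z2bdry_eq_zero_of_card (K : Finset (Finset V)) (n : ℕ) (c : Finset V → ZMod 2)
    (hc : ∀ s, c s ≠ 0 → s.card = n + 1) (t : Finset V) (ht : t.card ≠ n) :
    z2bdry K c t = 0 := by
  unfold z2bdry
  apply Finset.sum_eq_zero
  intro v hv
  by_contra h
  have := hc _ h
  rw [Finset.card_insert_of_notMem (Finset.mem_sdiff.1 hv).2] at this
  omega

/-- In a top dimension no nonzero cycles. -/
theorem no_cycle (K P : Finset (Finset V)) (n : ℕ) (hPK : P ⊆ K)
    (hP : ∀ s ∈ P, s.card = n + 1) (htop : ∀ s ∈ K, s.card ≤ n + 1) (hac : Z2Acyclic K)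
    (c : Finset V → ZMod 2) (hc : ∀ s, c s ≠ 0 → s ∈ P)
    (h0 : ∀ t : Finset V, t.card = n → bdP P c t = 0) : c = 0 := by
  obtain ⟨c', h1, h2⟩ := hac (n + 1) c (fun s hs => ⟨hP s (hc s hs), Or.inl (hPK (hc s hs))⟩) (by
    funext t
    by_cases ht : t.card = n
    · rw [z2bdry_eq_bdP K P n hPK hP c hc t ht, h0 t ht]; rfl
    · exact z2bdry_eq_zero_of_card K n c (fun s hs => hP s (hc s hs)) t ht)
  have hz : c' = 0 := by
    funext s
    by_contra h
    obtain ⟨h3, h4⟩ := h1 s h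
    rcases h4 with h4 | h4
    · have := htop s h4; omega
    · subst h4; simp at h3
  rw [← h2, hz]
  funext t
  simp [z2bdry]

theorem z2_even (n : ℕ) (h : Even n) : (n : ZMod 2) = 0 := (ZMod.natCast_eq_zero_iff_even).2 h

/-- Double boundary coefficient vanishes: sets between `t` and `s`. -/
theorem card_between (s t : Finset V) (n : ℕ) (hts : t ⊆ s) (ht : t.card = n)
    (hs : s.card = n + 2) (E : Finset (Finset V)) (hE : ∀ e ∈ E, e.card = n + 1)
    (hE' : ∀ e, e ⊆ s → e.card = n + 1 → e ∈ E) :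
    (E.filter (fun e => t ⊆ e ∧ e ⊆ s)).card = 2 := by
  have : E.filter (fun e => t ⊆ e ∧ e ⊆ s) = (s \ t).image (fun v => insert v t) := by
    ext e
    simp only [Finset.mem_filter, Finset.mem_image, Finset.mem_sdiff]
    constructor
    · rintro ⟨he, h1, h2⟩
      have hcard : (e \ t).card = 1 := by
        rw [Finset.card_sdiff_of_subset h1, hE e he, ht]; omega
      obtain ⟨v, hv⟩ := Finset.card_eq_one.1 hcard
      have hvs : v ∈ e \ t := by rw [hv]; simp
      rw [Finset.mem_sdiff] at hvs
      exact ⟨v, ⟨h2 hvs.1, hvs.2⟩, by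
        rw [Finset.insert_eq, ← hv, Finset.sdiff_union_of_subset h1]⟩
    · rintro ⟨v, ⟨h1, h2⟩, rfl⟩
      have hsub : insert v t ⊆ s := Finset.insert_subset h1 hts
      exact ⟨hE' _ hsub (by rw [Finset.card_insert_of_notMem h2, ht]),
        Finset.subset_insert _ _, hsub⟩
  rw [this, Finset.card_image_of_injOn, Finset.card_sdiff_of_subset hts, hs, ht]
  · omega
  · intro v hv w hw h
    have hv' : v ∈ insert w t := by
      have h' : insert v t = insert w t := h
      exact h' ▸ Finset.mem_insert_self v t
    rcases Finset.mem_insert.1 hv' with h1 | h1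
    · exact h1
    · exact absurd h1 (Finset.mem_sdiff.1 (Finset.mem_coe.1 hv)).2

/-- `∂∂ = 0` for families. -/
theorem bdP_bdP (P E : Finset (Finset V)) (n : ℕ) (hP : ∀ s ∈ P, s.card = n + 2)
    (hE : ∀ e ∈ E, e.card = n + 1)
    (hE' : ∀ s ∈ P, ∀ e, e ⊆ s → e.card = n + 1 → e ∈ E) (c : Finset V → ZMod 2)
    (t : Finset V) (ht : t.card = n) : bdP E (bdP P c) t = 0 := by
  unfold bdP
  simp only [Finset.sum_filter]
  have : ∀ e ∈ E, (if t ⊆ e then ∑ s ∈ P, if e ⊆ s then c s else 0 else 0)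
      = ∑ s ∈ P, if t ⊆ e ∧ e ⊆ s then c s else 0 := by
    intro e _
    by_cases h : t ⊆ e <;> simp [h]
  rw [Finset.sum_congr rfl this, Finset.sum_comm]
  apply Finset.sum_eq_zero
  intro s hs
  rw [← Finset.sum_filter, Finset.sum_const]
  by_cases hts : t ⊆ s
  · rw [card_between s t n hts ht (hP s hs) E hE (hE' s hs), two_nsmul]
    exact CharTwo.add_self_eq_zero _
  · rw [Finset.filter_false_of_mem]
    · simp
    · rintro e _ ⟨h1, h2⟩
      exact hts (h1.trans h2)

theorem double_count (W E : Finset (Finset V)) :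
    ∑ t ∈ W, (E.filter (fun s => t ⊆ s)).card = ∑ s ∈ E, (W.filter (fun t => t ⊆ s)).card := by
  simp only [Finset.card_filter]
  rw [Finset.sum_comm]

/-- A nonempty graph with no vertex of degree one has a nonzero cycle. -/
theorem graph_cycle (E : Finset (Finset V)) (hE : ∀ s ∈ E, s.card = 2) (hne : E.Nonempty)
    (hdeg : ∀ t : Finset V, t.card = 1 → (E.filter (fun s => t ⊆ s)).card ≠ 1)
    (hno : ∀ c : Finset V → ZMod 2, (∀ s, c s ≠ 0 → s ∈ E) →
      (∀ t : Finset V, t.card = 1 → bdP E c t = 0) → c = 0) : False := by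
  let W : Finset (Finset V) := E.biUnion (Finset.powersetCard 1)
  have hW : ∀ t ∈ W, t.card = 1 := by
    intro t ht
    obtain ⟨s, _, h2⟩ := Finset.mem_biUnion.1 ht
    exact (Finset.mem_powersetCard.1 h2).2
  have hW' : ∀ s ∈ E, ∀ t, t ⊆ s → t.card = 1 → t ∈ W := fun s hs t h1 h2 =>
    Finset.mem_biUnion.2 ⟨s, hs, Finset.mem_powersetCard.2 ⟨h1, h2⟩⟩
  have hd2 : ∀ t ∈ W, 2 ≤ (E.filter (fun s => t ⊆ s)).card := by
    intro t ht
    obtain ⟨s, h1, h2⟩ := Finset.mem_biUnion.1 ht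
    have := hdeg t (hW t ht)
    have : 0 < (E.filter (fun s => t ⊆ s)).card :=
      Finset.card_pos.2 ⟨s, Finset.mem_filter.2 ⟨h1, (Finset.mem_powersetCard.1 h2).1⟩⟩
    omega
  have hcount : ∑ t ∈ W, (E.filter (fun s => t ⊆ s)).card = ∑ s ∈ E, 2 := by
    rw [double_count]
    apply Finset.sum_congr rfl
    intro s hs
    have := card_between s ∅ 0 (by simp) (by simp) (hE s hs) W hW (hW' s hs)
    simpa using this
  have hle : W.card ≤ E.card := by
    have := Finset.sum_le_sum hd2
    rw [hcount] at this
    simp at this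
    omega
  obtain ⟨s0, hs0⟩ := hne
  obtain ⟨t0, ht0s, ht0⟩ := Finset.exists_subset_card_eq (s := s0) (n := 1) (by rw [hE s0 hs0]; omega)
  have ht0W := hW' s0 hs0 t0 ht0s ht0
  let ext : ({s // s ∈ E} → ZMod 2) → Finset V → ZMod 2 := fun x s =>
    if h : s ∈ E then x ⟨s, h⟩ else 0
  let f : ({s // s ∈ E} → ZMod 2) →ₗ[ZMod 2] ({t // t ∈ W.erase t0} → ZMod 2) :=
    { toFun := fun x t => bdP E (ext x) t
      map_add' := by
        intro x y
        funext t
        simp only [bdP, Pi.add_apply, ← Finset.sum_add_distrib]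
        apply Finset.sum_congr rfl
        intro s hs
        simp [ext, (Finset.mem_filter.1 hs).1]
      map_smul' := by
        intro a x
        funext t
        simp only [bdP, Pi.smul_apply, smul_eq_mul, RingHom.id_apply, Finset.mul_sum]
        apply Finset.sum_congr rfl
        intro s hs
        simp [ext, (Finset.mem_filter.1 hs).1] }
  have hinj : Function.Injective f := by
    rw [← LinearMap.ker_eq_bot, LinearMap.ker_eq_bot']
    intro x hx
    have hx' : ∀ t ∈ W.erase t0, bdP E (ext x) t = 0 := fun t ht => congrFun hx ⟨t, ht⟩
    have htot := bdP_bdP E W 0 hE hW hW' (ext x) ∅ (by simp)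
    have htot' : ∑ t ∈ W, bdP E (ext x) t = 0 := by
      rw [bdP] at htot
      simpa using htot
    rw [← Finset.add_sum_erase _ _ ht0W, Finset.sum_eq_zero hx', add_zero] at htot'
    have hz : ext x = 0 := by
      apply hno
      · intro s hs
        by_contra h
        exact hs (by simp [ext, h])
      · intro t ht
        by_cases htW : t ∈ W
        · by_cases h : t = t0
          · rw [h]; exact htot'
          · exact hx' t (Finset.mem_erase.2 ⟨h, htW⟩)
        · unfold bdP
          apply Finset.sum_eq_zero
          intro s hs
          obtain ⟨h1, h2⟩ := Finset.mem_filter.1 hs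
          exact absurd (hW' s h1 t h2 ht) htW
    funext ⟨s, hs⟩
    have hs' : s ∈ E := hs
    have := congrFun hz s
    simpa [ext, hs'] using this
  have h1 := LinearMap.finrank_le_finrank_of_injective hinj
  rw [Module.finrank_pi, Module.finrank_pi] at h1
  have hpos : 0 < W.card := Finset.card_pos.2 ⟨_, ht0W⟩
  simp [Finset.card_erase_of_mem ht0W] at h1
  omega

/-- Boundary of an indicator of an edge. -/
theorem bdP_single (E : Finset (Finset V)) (e : Finset V) (he : e ∈ E) (t : Finset V) :
    bdP E (Pi.single e 1) t = if t ⊆ e then 1 else 0 := by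
  unfold bdP
  by_cases h : t ⊆ e
  · rw [Finset.sum_eq_single e]
    · simp [h]
    · intro b _ hb; simp [hb]
    · intro h'; exact absurd (Finset.mem_filter.2 ⟨he, h⟩) h'
  · simp only [h, if_false]
    apply Finset.sum_eq_zero
    intro s hs
    have : s ≠ e := by rintro rfl; exact h (Finset.mem_filter.1 hs).2
    simp [this]

theorem bdP_add (E : Finset (Finset V)) (c d : Finset V → ZMod 2) (t : Finset V) :
    bdP E (c + d) t = bdP E c t + bdP E d t := by
  simp [bdP, Finset.sum_add_distrib]

theorem bdP_zero (E : Finset (Finset V)) (t : Finset V) : bdP E 0 t = 0 := by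
  simp [bdP]

/-- For `E` a graph, a chain joining adjacent or equal vertices. -/
theorem edge_chain (E : Finset (Finset V)) (a b : V) (h : a = b ∨ ({a, b} : Finset V) ∈ E) :
    ∃ q : Finset V → ZMod 2, ∀ v : V, bdP E q {v} =
      (if v = a then 1 else 0) + (if v = b then 1 else 0) := by
  by_cases hab : a = b
  · subst hab
    refine ⟨0, fun v => ?_⟩
    rw [bdP_zero, CharTwo.add_self_eq_zero]
  · rcases h with h | h
    · exact absurd h hab
    · refine ⟨Pi.single {a, b} 1, fun v => ?_⟩
      rw [bdP_single E _ h]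
      by_cases h1 : v = a
      · subst h1; simp [hab]
      · by_cases h2 : v = b
        · subst h2; simp [h1]
        · simp [h1, h2]

/-- The counting inequality coming from injectivity of `∂₂` and connectivity. -/
theorem dim_count (P E : Finset (Finset V)) (W : Finset V) (hP : ∀ s ∈ P, s.card = 3)
    (hE : ∀ e ∈ E, e.card = 2) (hE' : ∀ s ∈ P, ∀ e, e ⊆ s → e.card = 2 → e ∈ E)
    (v0 : V) (hv0 : v0 ∈ W)
    (hconn : ∀ u ∈ W, ∃ w, (v0 = w ∨ ({v0, w} : Finset V) ∈ E) ∧ (w = u ∨ ({w, u} : Finset V) ∈ E))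
    (hno : ∀ c : Finset V → ZMod 2, (∀ s, c s ≠ 0 → s ∈ P) →
      (∀ t : Finset V, t.card = 2 → bdP P c t = 0) → c = 0) :
    P.card + W.card ≤ E.card + 1 := by
  have hq : ∀ u : {u // u ∈ W.erase v0}, ∃ q : Finset V → ZMod 2, ∀ v : V, v ≠ v0 →
      bdP E q {v} = if v = u then 1 else 0 := by
    rintro ⟨u, hu⟩
    obtain ⟨w, h1, h2⟩ := hconn u (Finset.mem_of_mem_erase hu)
    obtain ⟨q1, hq1⟩ := edge_chain E v0 w h1
    obtain ⟨q2, hq2⟩ := edge_chain E w u h2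
    refine ⟨q1 + q2, fun v hv => ?_⟩
    rw [bdP_add, hq1, hq2]
    simp only [hv, if_false, zero_add]
    rw [← add_assoc, CharTwo.add_self_eq_zero, zero_add]
  choose q hq using hq
  let ext : ({s // s ∈ P} → ZMod 2) → Finset V → ZMod 2 := fun x s =>
    if h : s ∈ P then x ⟨s, h⟩ else 0
  let f : (({s // s ∈ P} → ZMod 2) × ({u // u ∈ W.erase v0} → ZMod 2)) →ₗ[ZMod 2]
      ({e // e ∈ E} → ZMod 2) :=
    { toFun := fun x e => bdP P (ext x.1) e + ∑ u, x.2 u * q u e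
      map_add' := by
        intro x y
        funext e
        have : ext (x + y).1 = ext x.1 + ext y.1 := by
          funext s
          by_cases h : s ∈ P <;> simp [ext, h]
        simp only [this, bdP_add, Pi.add_apply, Prod.snd_add, add_mul, Finset.sum_add_distrib]
        ring
      map_smul' := by
        intro a x
        funext e
        simp only [bdP, Pi.smul_apply, smul_eq_mul, RingHom.id_apply, Finset.mul_sum, mul_add,
          Prod.smul_snd, mul_assoc]
        congr 1
        apply Finset.sum_congr rfl
        intro s hs
        simp [ext, (Finset.mem_filter.1 hs).1] }
  have hinj : Function.Injective f := by
    rw [← LinearMap.ker_eq_bot, LinearMap.ker_eq_bot']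
    rintro ⟨x, y⟩ hx
    have hx' : ∀ e ∈ E, bdP P (ext x) e + ∑ u, y u * q u e = 0 := fun e he => congrFun hx ⟨e, he⟩
    have hy : y = 0 := by
      funext v
      have hvne : (v : V) ≠ v0 := (Finset.mem_erase.1 v.2).1
      have h1 : bdP E (fun e => bdP P (ext x) e + ∑ u, y u * q u e) {(v : V)} = 0 := by
        unfold bdP
        apply Finset.sum_eq_zero
        intro e he
        exact hx' e (Finset.mem_filter.1 he).1
      have h2 : bdP E (fun e => bdP P (ext x) e + ∑ u, y u * q u e) {(v : V)} =
          bdP E (bdP P (ext x)) {(v : V)} + ∑ u, y u * bdP E (q u) {(v : V)} := by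
        simp only [bdP, Finset.sum_add_distrib, Finset.mul_sum]
        congr 1
        rw [Finset.sum_comm]
      rw [h2, bdP_bdP P E 1 hP hE hE' _ _ (by simp), zero_add] at h1
      have h3 : ∀ u, y u * bdP E (q u) {(v : V)} = if v = u then y u else 0 := by
        intro u
        rw [hq u v hvne]
        by_cases h : v = u
        · simp [h]
        · simp [h]
      simp only [h3] at h1
      simpa using h1
    subst hy
    have hz : ext x = 0 := by
      apply hno
      · intro s hs
        by_contra h
        exact hs (by simp [ext, h])
      · intro t ht
        by_cases htE : t ∈ E
        · simpa using hx' t htE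
        · unfold bdP
          apply Finset.sum_eq_zero
          intro s hs
          obtain ⟨h1, h2⟩ := Finset.mem_filter.1 hs
          exact absurd (hE' s h1 t h2 ht) htE
    have : x = 0 := by
      funext ⟨s, hs⟩
      have := congrFun hz s
      simpa [ext, hs] using this
    rw [this]; rfl
  have h1 := LinearMap.finrank_le_finrank_of_injective hinj
  rw [Module.finrank_prod, Module.finrank_pi, Module.finrank_pi, Module.finrank_pi] at h1
  have hpos : 0 < W.card := Finset.card_pos.2 ⟨_, hv0⟩
  simp [Finset.card_erase_of_mem hv0] at h1
  omega

theorem tetra_even (x y z g : V) (hxy : x ≠ y) (hxz : x ≠ z) (hyz : y ≠ z) (hgx : g ≠ x)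
    (hgy : g ≠ y) (hgz : g ≠ z) (t : Finset V) (ht : t.card = 2) :
    (if t ⊆ ({x, y, z} : Finset V) then (1 : ZMod 2) else 0) +
      (if t ⊆ insert g ({x, y} : Finset V) then 1 else 0) +
      (if t ⊆ insert g ({x, z} : Finset V) then 1 else 0) +
      (if t ⊆ insert g ({y, z} : Finset V) then 1 else 0) = 0 := by
  obtain ⟨p, q, hpq, rfl⟩ := Finset.card_eq_two.1 ht
  have h2 : (1 : ZMod 2) + 1 = 0 := by decide
  simp only [Finset.insert_subset_iff, Finset.singleton_subset_iff, Finset.mem_insert,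
    Finset.mem_singleton]
  by_cases h1 : p = x
  · subst h1
    by_cases h3 : q = y
    · subst h3; simp [*, Ne.symm hgy, Ne.symm hgx, Ne.symm hgz, Ne.symm hpq]
    by_cases h4 : q = z
    · subst h4; simp [*, Ne.symm hgy, Ne.symm hgx, Ne.symm hgz, Ne.symm hpq]
    by_cases h5 : q = g <;> simp [*, Ne.symm hpq, Ne.symm hgx]
  by_cases h1 : p = y
  · subst h1
    by_cases h3 : q = x
    · subst h3; simp [*, Ne.symm hgy, Ne.symm hgx, Ne.symm hgz, Ne.symm hpq]
    by_cases h4 : q = z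
    · subst h4; simp [*, Ne.symm hgy, Ne.symm hgx, Ne.symm hgz, Ne.symm hpq]
    by_cases h5 : q = g <;> simp [*, Ne.symm hpq, Ne.symm hgy]
  by_cases h1 : p = z
  · subst h1
    by_cases h3 : q = x
    · subst h3; simp [*, Ne.symm hgy, Ne.symm hgx, Ne.symm hgz, Ne.symm hpq]
    by_cases h4 : q = y
    · subst h4; simp [*, Ne.symm hgy, Ne.symm hgx, Ne.symm hgz, Ne.symm hpq]
    by_cases h5 : q = g <;> simp [*, Ne.symm hpq, Ne.symm hgz]
  by_cases h1 : p = g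
  · subst h1
    by_cases h3 : q = x
    · subst h3; simp [*, Ne.symm hpq]
    by_cases h4 : q = y
    · subst h4; simp [*, Ne.symm hpq]
    by_cases h5 : q = z
    · subst h5; simp [*, Ne.symm hpq]
    simp [*, Ne.symm hpq]
  simp [*, Ne.symm hpq]

/-- A nonempty family of triangles on at most seven vertices in which no edge has degree one
carries a nonzero mod 2 cycle. -/
theorem tri_cycle (P : Finset (Finset V)) (hP : ∀ s ∈ P, s.card = 3) (hne : P.Nonempty)
    (h7 : (P.biUnion id).card ≤ 7)
    (hdeg : ∀ t : Finset V, t.card = 2 → (P.filter (fun s => t ⊆ s)).card ≠ 1)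
    (hno : ∀ c : Finset V → ZMod 2, (∀ s, c s ≠ 0 → s ∈ P) →
      (∀ t : Finset V, t.card = 2 → bdP P c t = 0) → c = 0) : False := by
  set W := P.biUnion id with hWdef
  have hPW : ∀ s ∈ P, s ⊆ W := fun s hs => Finset.subset_biUnion_of_mem id hs
  obtain ⟨E, hEdef⟩ : ∃ E, E = P.biUnion (Finset.powersetCard 2) := ⟨_, rfl⟩
  have hE : ∀ t ∈ E, t.card = 2 := by
    intro t ht
    rw [hEdef] at ht
    obtain ⟨s, _, h2⟩ := Finset.mem_biUnion.1 ht
    exact (Finset.mem_powersetCard.1 h2).2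
  have hE' : ∀ s ∈ P, ∀ t, t ⊆ s → t.card = 2 → t ∈ E := fun s hs t h1 h2 => by
    rw [hEdef]
    exact Finset.mem_biUnion.2 ⟨s, hs, Finset.mem_powersetCard.2 ⟨h1, h2⟩⟩
  have hEP : ∀ t ∈ E, ∃ s ∈ P, t ⊆ s := by
    intro t ht
    rw [hEdef] at ht
    obtain ⟨s, h1, h2⟩ := Finset.mem_biUnion.1 ht
    exact ⟨s, h1, (Finset.mem_powersetCard.1 h2).1⟩
  have hd2 : ∀ t ∈ E, 2 ≤ (P.filter (fun s => t ⊆ s)).card := by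
    intro t ht
    obtain ⟨s, h1, h2⟩ := hEP t ht
    have := hdeg t (hE t ht)
    have : 0 < (P.filter (fun s => t ⊆ s)).card :=
      Finset.card_pos.2 ⟨s, Finset.mem_filter.2 ⟨h1, h2⟩⟩
    omega
  have hcount : ∑ t ∈ E, (P.filter (fun s => t ⊆ s)).card = 3 * P.card := by
    rw [double_count, mul_comm, ← smul_eq_mul, ← Finset.sum_const]
    apply Finset.sum_congr rfl
    intro s hs
    have : E.filter (fun t => t ⊆ s) = Finset.powersetCard 2 s := by
      ext t
      simp only [Finset.mem_filter, Finset.mem_powersetCard]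
      exact ⟨fun h => ⟨h.2, hE t h.1⟩, fun h => ⟨hE' s hs t h.1 h.2, h.1⟩⟩
    rw [this, Finset.card_powersetCard, hP s hs]
    rfl
  have hEle : E.card ≤ W.card.choose 2 := by
    rw [← Finset.card_powersetCard]
    apply Finset.card_le_card
    intro t ht
    obtain ⟨s, h1, h2⟩ := hEP t ht
    exact Finset.mem_powersetCard.2 ⟨h2.trans (hPW s h1), hE t ht⟩
  -- neighbourhoods
  let N : V → Finset V := fun v => W.filter (fun w => v = w ∨ ({v, w} : Finset V) ∈ E)
  have hsN : ∀ s ∈ P, ∀ v ∈ s, s ⊆ N v := by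
    intro s hs v hv w hw
    refine Finset.mem_filter.2 ⟨hPW s hs hw, ?_⟩
    by_cases h : v = w
    · exact Or.inl h
    · refine Or.inr (hE' s hs _ ?_ (Finset.card_pair h))
      intro a ha
      rcases Finset.mem_insert.1 ha with rfl | ha
      · exact hv
      · rw [Finset.mem_singleton.1 ha]; exact hw
  have hN4 : ∀ v ∈ W, 4 ≤ (N v).card := by
    intro v hv
    obtain ⟨s, hs, hvs⟩ := Finset.mem_biUnion.1 hv
    have hvs : v ∈ s := hvs
    obtain ⟨e, hve, hes, hec⟩ := Finset.exists_subsuperset_card_eq (s := {v}) (t := s) (n := 2)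
      (by simpa using hvs) (by simp) (by rw [hP s hs]; omega)
    have h2 := hd2 e (hE' s hs e hes hec)
    obtain ⟨s', hs', hne'⟩ := Finset.exists_mem_ne (s := P.filter (fun s => e ⊆ s)) (by omega) s
    obtain ⟨hs'P, hes'⟩ := Finset.mem_filter.1 hs'
    have hve' : v ∈ e := by simpa using hve
    have hsub : s ∪ s' ⊆ N v := Finset.union_subset (hsN s hs v hvs) (hsN s' hs'P v (hes' hve'))
    have hlt : s.card < (s ∪ s').card := by
      apply Finset.card_lt_card
      refine Finset.ssubset_iff_subset_ne.2 ⟨Finset.subset_union_left, ?_⟩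
      intro h
      apply hne'
      apply Finset.eq_of_subset_of_card_le
      · rw [h]; exact Finset.subset_union_right
      · rw [hP s hs, hP s' hs'P]
    have := Finset.card_le_card hsub
    have := hP s hs
    omega
  have hconn : ∀ v0 ∈ W, ∀ u ∈ W, ∃ w, (v0 = w ∨ ({v0, w} : Finset V) ∈ E) ∧
      (w = u ∨ ({w, u} : Finset V) ∈ E) := by
    intro v0 hv0 u hu
    have h1 := hN4 v0 hv0
    have h2 := hN4 u hu
    have h3 : (N v0 ∪ N u).card ≤ W.card := Finset.card_le_card
      (Finset.union_subset (Finset.filter_subset _ _) (Finset.filter_subset _ _))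
    have h4 := Finset.card_union_add_card_inter (N v0) (N u)
    have h5 : 0 < (N v0 ∩ N u).card := by omega
    obtain ⟨w, hw⟩ := Finset.card_pos.1 h5
    rw [Finset.mem_inter] at hw
    refine ⟨w, (Finset.mem_filter.1 hw.1).2, ?_⟩
    rcases (Finset.mem_filter.1 hw.2).2 with h | h
    · exact Or.inl h.symm
    · rw [Finset.pair_comm] at h; exact Or.inr h
  obtain ⟨s0, hs0⟩ := hne
  obtain ⟨v0, hv0⟩ : s0.Nonempty := Finset.card_pos.1 (by rw [hP s0 hs0]; omega)
  have hv0W : v0 ∈ W := hPW s0 hs0 hv0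
  have hdim := dim_count P E W hP hE hE' v0 hv0W (hconn v0 hv0W) hno
  -- odd edges
  let ind : Finset V → ZMod 2 := fun s => if s ∈ P then 1 else 0
  have hind : ∀ t, bdP P ind t = ((P.filter (fun s => t ⊆ s)).card : ZMod 2) := by
    intro t
    unfold bdP
    rw [Finset.card_eq_sum_ones, Nat.cast_sum]
    apply Finset.sum_congr rfl
    intro s hs
    simp [ind, (Finset.mem_filter.1 hs).1]
  obtain ⟨O, hO⟩ : ∃ O, O = E.filter (fun t => bdP P ind t ≠ 0) := ⟨_, rfl⟩
  have hOE : ∀ t ∈ O, t ∈ E := fun t ht => by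
    rw [hO] at ht
    exact (Finset.mem_filter.1 ht).1
  have hz2 : ∀ a : ZMod 2, a ≠ 0 → a = 1 := by decide
  have hOone : ∀ t, t.card = 2 → bdP P ind t = if t ∈ O then 1 else 0 := by
    intro t ht
    by_cases h : t ∈ O
    · simp only [h, if_true]
      rw [hO] at h
      exact hz2 _ (Finset.mem_filter.1 h).2
    · simp only [h, if_false]
      by_contra h0
      apply h
      rw [hO]
      refine Finset.mem_filter.2 ⟨?_, h0⟩
      by_contra htE
      apply h0
      rw [hind, Finset.filter_false_of_mem]
      · simp
      · intro s hs hts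
        exact htE (hE' s hs t hts ht)
  have hOne : O.Nonempty := by
    by_contra h
    rw [Finset.not_nonempty_iff_eq_empty] at h
    have := hno ind (by
      intro s hs
      by_contra h
      exact hs (by simp [ind, h])) (by
      intro t ht
      rw [hOone t ht, h]; simp)
    have := congrFun this s0
    simp [ind, hs0] at this
  have hOodd : ∀ v : V, ∀ e ∈ O, v ∈ e → ∃ e' ∈ O, e' ≠ e ∧ v ∈ e' := by
    intro v e he hve
    by_contra hcon
    push Not at hcon
    have h0 := bdP_bdP P E 1 hP hE hE' ind {v} (by simp)
    have h1 : bdP E (bdP P ind) {v} = bdP P ind e := by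
      show ∑ s ∈ E.filter (fun s => {v} ⊆ s), bdP P ind s = _
      apply Finset.sum_eq_single
      · intro b hb hbe
        obtain ⟨hbE, hvb⟩ := Finset.mem_filter.1 hb
        rw [hOone b (hE b hbE), if_neg]
        intro hbO
        exact hcon b hbO hbe (by simpa using hvb)
      · intro h
        exact absurd (Finset.mem_filter.2 ⟨hOE e he, by simpa using hve⟩) h
    rw [h1, hOone e (hE e (hOE e he)), if_pos he] at h0
    exact one_ne_zero h0
  obtain ⟨e1, he1⟩ := hOne
  obtain ⟨x, y, hxy, rfl⟩ := Finset.card_eq_two.1 (hE e1 (hOE e1 he1))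
  obtain ⟨e2, he2, he21, hxe2⟩ := hOodd x _ he1 (by simp)
  obtain ⟨e3, he3, he31, hye3⟩ := hOodd y _ he1 (by simp)
  have hye2 : y ∉ e2 := by
    intro h
    apply he21
    symm
    apply Finset.eq_of_subset_of_card_le
    · intro a ha
      rcases Finset.mem_insert.1 ha with rfl | ha
      · exact hxe2
      · rw [Finset.mem_singleton.1 ha]; exact h
    · rw [hE _ (hOE _ he2), Finset.card_pair hxy]
  have he23 : e2 ≠ e3 := by rintro rfl; exact hye2 hye3
  have hsub3 : ({{x, y}, e2, e3} : Finset (Finset V)) ⊆ O := by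
    intro a ha
    simp only [Finset.mem_insert, Finset.mem_singleton] at ha
    rcases ha with rfl | rfl | rfl <;> assumption
  have hcard3 : ({{x, y}, e2, e3} : Finset (Finset V)).card = 3 :=
    Finset.card_eq_three.2 ⟨_, _, _, he21.symm, he31.symm, he23, rfl⟩
  have hO3 : 3 ≤ O.card := hcard3 ▸ Finset.card_le_card hsub3
  -- excess
  have hge : ∀ t ∈ E, 2 + (if t ∈ O then 1 else 0) ≤ (P.filter (fun s => t ⊆ s)).card := by
    intro t ht
    have h2 := hd2 t ht
    by_cases h : t ∈ O
    · simp only [h, if_true]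
      have h1 := hOone t (hE t ht)
      rw [if_pos h, hind] at h1
      rcases Nat.lt_or_ge 2 (P.filter (fun s => t ⊆ s)).card with h3 | h3
      · exact h3
      · have : (P.filter (fun s => t ⊆ s)).card = 2 := by omega
        rw [this] at h1
        exact absurd h1 (by decide)
    · simpa [h] using h2
  have hsumO : ∑ t ∈ E, (2 + (if t ∈ O then 1 else 0)) = 2 * E.card + O.card := by
    rw [Finset.sum_add_distrib, Finset.sum_const, ← Finset.card_filter]
    have : E.filter (fun t => t ∈ O) = O := by
      ext t
      simp only [Finset.mem_filter]
      exact ⟨fun h => h.2, fun h => ⟨hOE t h, h⟩⟩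
    rw [this, smul_eq_mul, mul_comm]
  have hsumle := Finset.sum_le_sum hge
  rw [hsumO, hcount] at hsumle
  have hWpos : 0 < W.card := Finset.card_pos.2 ⟨_, hv0W⟩
  have hnum : W.card = 7 ∧ E.card = 21 ∧ P.card = 15 ∧ O.card = 3 := by
    rw [Nat.choose_two_right] at hEle
    generalize W.card = n at *
    interval_cases n <;> omega
  obtain ⟨hW7, hE21, hP15, hOc⟩ := hnum
  have hdegO : ∀ t ∈ O, (P.filter (fun s => t ⊆ s)).card = 3 := by
    have heq := (Finset.sum_eq_sum_iff_of_le hge).1 (by rw [hsumO, hcount]; omega)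
    intro t ht
    rw [← heq t (hOE t ht), if_pos ht]
  have hOeq : ({{x, y}, e2, e3} : Finset (Finset V)) = O :=
    Finset.eq_of_subset_of_card_le hsub3 (by omega)
  obtain ⟨z, hz⟩ : ∃ z, e2 = {x, z} := by
    obtain ⟨a, b, _, rfl⟩ := Finset.card_eq_two.1 (hE _ (hOE _ he2))
    rcases Finset.mem_insert.1 hxe2 with rfl | h
    · exact ⟨b, rfl⟩
    · rw [Finset.mem_singleton.1 h]; exact ⟨a, Finset.pair_comm _ _⟩
  subst hz
  have hxz : x ≠ z := by
    rintro rfl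
    have := hE _ (hOE _ he2)
    simp at this
  have hyz : y ≠ z := by
    rintro rfl
    simp at hye2
  have hze3 : z ∈ e3 := by
    obtain ⟨e4, he4, he42, hze4⟩ := hOodd z _ he2 (by simp)
    rw [← hOeq] at he4
    simp only [Finset.mem_insert, Finset.mem_singleton] at he4
    rcases he4 with rfl | rfl | rfl
    · simp [Ne.symm hxz, Ne.symm hyz] at hze4
    · exact absurd rfl he42
    · exact hze4
  have he3 : {y, z} = e3 := by
    apply Finset.eq_of_subset_of_card_le
    · intro a ha
      rcases Finset.mem_insert.1 ha with rfl | ha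
      · exact hye3
      · rw [Finset.mem_singleton.1 ha]; exact hze3
    · rw [hE _ (hOE _ he3), Finset.card_pair hyz]
  subst he3
  have hT3 : ({x, y, z} : Finset V).card = 3 := Finset.card_eq_three.2 ⟨_, _, _, hxy, hxz, hyz, rfl⟩
  have hOT : O = Finset.powersetCard 2 {x, y, z} := by
    apply Finset.eq_of_subset_of_card_le
    · intro t ht
      refine Finset.mem_powersetCard.2 ⟨?_, hE t (hOE t ht)⟩
      rw [← hOeq] at ht
      simp only [Finset.mem_insert, Finset.mem_singleton] at ht
      rcases ht with rfl | rfl | rfl <;> intro a <;> simp <;> tauto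
    · rw [Finset.card_powersetCard, hT3, hOc]; decide
  have hbd : ∀ t, t.card = 2 → bdP P ind t = if t ⊆ {x, y, z} then 1 else 0 := by
    intro t ht
    rw [hOone t ht, hOT]
    simp [Finset.mem_powersetCard, ht]
  have hTP : ({x, y, z} : Finset V) ∉ P := by
    intro hT
    have hc := hno (ind + Pi.single {x, y, z} 1) (by
      intro s hs
      by_contra h
      have hne : s ≠ {x, y, z} := by rintro rfl; exact h hT
      exact hs (by simp [ind, h, hne])) (by
      intro t ht
      rw [bdP_add, hbd t ht, bdP_single P _ hT, CharTwo.add_self_eq_zero])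
    obtain ⟨s, hs, hne⟩ := Finset.exists_mem_ne (s := P) (by omega) {x, y, z}
    have := congrFun hc s
    simp [ind, hs, hne] at this
  have hTW : ({x, y, z} : Finset V) ⊆ W := by
    have hOW : ∀ t ∈ O, t ⊆ W := fun t ht => by
      obtain ⟨s, h1, h2⟩ := hEP t (hOE t ht)
      exact h2.trans (hPW s h1)
    have hx := hOW _ he1 (Finset.mem_insert_self x _)
    have hy := hOW _ he1 (Finset.mem_insert_of_mem (Finset.mem_singleton_self y))
    have hz := hOW _ he2 (Finset.mem_insert_of_mem (Finset.mem_singleton_self z))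
    intro a ha
    simp only [Finset.mem_insert, Finset.mem_singleton] at ha
    rcases ha with rfl | rfl | rfl <;> assumption
  obtain ⟨D, hD⟩ : ∃ D, D = W \ {x, y, z} := ⟨_, rfl⟩
  have hD4 : D.card = 4 := by
    rw [hD, Finset.card_sdiff_of_subset hTW, hT3, hW7]
  have hmiss : ∀ e ∈ O, (D.filter (fun g => ¬ insert g e ∈ P)).card ≤ 1 := by
    intro e he
    have h1 : P.filter (fun s => e ⊆ s) ⊆
        (D.filter (fun g => insert g e ∈ P)).image (fun g => insert g e) := by
      intro s hs
      obtain ⟨hsP, hes⟩ := Finset.mem_filter.1 hs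
      have hec := hE e (hOE e he)
      have hcard : (s \ e).card = 1 := by
        rw [Finset.card_sdiff_of_subset hes, hP s hsP, hec]
      obtain ⟨v, hv⟩ := Finset.card_eq_one.1 hcard
      have hvs : v ∈ s \ e := by rw [hv]; simp
      have hins : insert v e = s := by
        rw [Finset.insert_eq, ← hv, Finset.sdiff_union_of_subset hes]
      rw [Finset.mem_sdiff] at hvs
      refine Finset.mem_image.2 ⟨v, Finset.mem_filter.2 ⟨?_, by rw [hins]; exact hsP⟩, hins⟩
      rw [hD, Finset.mem_sdiff]
      refine ⟨hPW s hsP hvs.1, fun hvT => hTP ?_⟩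
      have heT : e ⊆ {x, y, z} := by
        rw [hOT] at he
        exact (Finset.mem_powersetCard.1 he).1
      have : s = {x, y, z} := by
        apply Finset.eq_of_subset_of_card_le
        · rw [← hins]; exact Finset.insert_subset hvT heT
        · rw [hT3, hP s hsP]
      rw [← this]; exact hsP
    have h2 := Finset.card_le_card h1
    rw [hdegO e he] at h2
    have h3 := h2.trans Finset.card_image_le
    have h4 := Finset.card_filter_add_card_filter_not (s := D) (fun g => insert g e ∈ P)
    omega
  obtain ⟨g, hgD, hg1, hg2, hg3⟩ : ∃ g ∈ D, insert g {x, y} ∈ P ∧ insert g {x, z} ∈ P ∧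
      insert g {y, z} ∈ P := by
    by_contra hcon
    push Not at hcon
    have hsub : D ⊆ (D.filter (fun g => ¬ insert g {x, y} ∈ P) ∪
        D.filter (fun g => ¬ insert g {x, z} ∈ P)) ∪ D.filter (fun g => ¬ insert g {y, z} ∈ P) := by
      intro g hg
      have := hcon g hg
      simp only [Finset.mem_union, Finset.mem_filter]
      tauto
    have h1 := hmiss _ he1
    have h2 := hmiss _ he2
    have h3 := hmiss {y, z} (by assumption)
    have h4 := Finset.card_le_card hsub
    have h5 := Finset.card_union_le (D.filter (fun g => ¬ insert g {x, y} ∈ P) ∪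
        D.filter (fun g => ¬ insert g {x, z} ∈ P)) (D.filter (fun g => ¬ insert g {y, z} ∈ P))
    have h6 := Finset.card_union_le (D.filter (fun g => ¬ insert g {x, y} ∈ P))
        (D.filter (fun g => ¬ insert g {x, z} ∈ P))
    omega
  have hgT : g ∉ ({x, y, z} : Finset V) := by
    rw [hD] at hgD
    exact (Finset.mem_sdiff.1 hgD).2
  simp only [Finset.mem_insert, Finset.mem_singleton, not_or] at hgT
  have hc := hno (ind + Pi.single (insert g {x, y}) 1 + Pi.single (insert g {x, z}) 1 +
      Pi.single (insert g {y, z}) 1) (by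
    intro s hs
    by_contra h
    have h1 : s ≠ insert g {x, y} := by rintro rfl; exact h hg1
    have h2 : s ≠ insert g {x, z} := by rintro rfl; exact h hg2
    have h3 : s ≠ insert g {y, z} := by rintro rfl; exact h hg3
    exact hs (by simp [ind, h, h1, h2, h3])) (by
    intro t ht
    rw [bdP_add, bdP_add, bdP_add, hbd t ht, bdP_single P _ hg1, bdP_single P _ hg2,
      bdP_single P _ hg3]
    exact tetra_even x y z g hxy hxz hyz hgT.1 hgT.2.1 hgT.2.2 t ht)
  obtain ⟨s, hs, hsn⟩ : ∃ s ∈ P,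
      s ∉ ({insert g {x, y}, insert g {x, z}, insert g {y, z}} : Finset (Finset V)) := by
    apply Finset.exists_mem_notMem_of_card_lt_card
    have := Finset.card_le_three (a := insert g {x, y}) (b := insert g {x, z})
      (c := insert g ({y, z} : Finset V))
    omega
  simp only [Finset.mem_insert, Finset.mem_singleton, not_or] at hsn
  have := congrFun hc s
  simp [ind, hs, hsn.1, hsn.2.1, hsn.2.2] at this

/-- A free face has codimension one in the face containing it. -/
theorem free_card (K : Finset (Finset V)) (hK : IsComplex K) (τ σ : Finset V)
    (hf : IsFreeFace K τ σ) : σ.card = τ.card + 1 := by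
  obtain ⟨hτ, hσ, hss, hu⟩ := hf
  obtain ⟨v, hvσ, hvτ⟩ := Finset.exists_of_ssubset hss
  have h1 : insert v τ ∈ K := hK.2.2 σ hσ _ (Finset.insert_subset hvσ hss.1) ⟨v, by simp⟩
  have h2 := hu _ h1 (Finset.ssubset_insert hvτ)
  rw [← h2, Finset.card_insert_of_notMem hvτ]

theorem collapse_complex (K : Finset (Finset V)) (hK : IsComplex K) (τ σ : Finset V)
    (hf : IsFreeFace K τ σ) : IsComplex ((K.erase τ).erase σ) := by
  obtain ⟨hτ, hσ, hss, hu⟩ := hf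
  refine ⟨?_, ?_, ?_⟩
  · obtain ⟨v, hvσ, hvτ⟩ := Finset.exists_of_ssubset hss
    obtain ⟨w, hw⟩ : τ.Nonempty := by
      rw [Finset.nonempty_iff_ne_empty]
      rintro rfl; exact hK.2.1 hτ
    refine ⟨{v}, ?_⟩
    simp only [Finset.mem_erase]
    refine ⟨?_, ?_, hK.2.2 σ hσ _ (by simpa using hvσ) (by simp)⟩
    · rintro rfl
      have : w ∈ ({v} : Finset V) := hss.1 hw
      rw [Finset.mem_singleton.1 this] at hw
      exact hvτ hw
    · rintro rfl; simp at hvτ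
  · intro h
    exact hK.2.1 (Finset.mem_of_mem_erase (Finset.mem_of_mem_erase h))
  · intro s hs t hts htne
    simp only [Finset.mem_erase] at hs ⊢
    obtain ⟨h1, h2, h3⟩ := hs
    refine ⟨?_, ?_, hK.2.2 s h3 t hts htne⟩
    · rintro rfl
      have hst : τ ⊂ s := hss.trans_subset hts
      exact h1 (hu s h3 hst)
    · rintro rfl
      exact h1 (hu s h3 (Finset.ssubset_iff_subset_ne.2 ⟨hts, fun h => h2 h.symm⟩))

theorem z2bdry_sub (K K' : Finset (Finset V)) (h : K' ⊆ K) (n : ℕ) (c : Finset V → ZMod 2)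
    (hc : z2chainOK K' n c) : z2bdry K c = z2bdry K' c := by
  funext t
  unfold z2bdry
  symm
  apply Finset.sum_subset
  · exact Finset.sdiff_subset_sdiff (Finset.sup_mono h) le_rfl
  · intro v hv hv'
    by_contra h0
    rcases (hc _ h0).2 with h1 | h1
    · apply hv'
      rw [Finset.mem_sdiff] at hv ⊢
      exact ⟨(Finset.le_sup (f := id) h1 : insert v t ≤ K'.sup id) (Finset.mem_insert_self _ _), hv.2⟩
    · exact absurd h1 (Finset.insert_ne_empty _ _)

theorem z2bdry_add (K : Finset (Finset V)) (c d : Finset V → ZMod 2) :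
    z2bdry K (c + d) = z2bdry K c + z2bdry K d := by
  funext t
  simp [z2bdry, Finset.sum_add_distrib]

theorem z2bdry_z2bdry (K : Finset (Finset V)) (c : Finset V → ZMod 2) :
    z2bdry K (z2bdry K c) = 0 := by
  funext t
  show ∑ v ∈ verts K \ t, ∑ w ∈ verts K \ insert v t, c (insert w (insert v t)) = 0
  rw [Finset.sum_sigma']
  refine Finset.sum_involution (fun p _ => ⟨p.2, p.1⟩) ?_ ?_ ?_ ?_
  · rintro ⟨v, w⟩ h
    simp only [Finset.insert_comm w v]
    exact CharTwo.add_self_eq_zero _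
  · rintro ⟨v, w⟩ h _ heq
    simp only [Finset.mem_sigma, Finset.mem_sdiff, Finset.mem_insert, not_or] at h
    simp only [Sigma.mk.injEq] at heq
    exact h.2.2.1 heq.1
  · rintro ⟨v, w⟩ h
    simp only [Finset.mem_sigma, Finset.mem_sdiff, Finset.mem_insert, not_or] at h ⊢
    exact ⟨⟨h.2.1, h.2.2.2⟩, h.1.1, fun h' => h.2.2.1 h'.symm, h.1.2⟩
  · rintro ⟨v, w⟩ h
    rfl

/-- The boundary of a chain is a chain. -/
theorem z2bdry_chain (K : Finset (Finset V)) (hK : IsComplex K) (n : ℕ) (c : Finset V → ZMod 2)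
    (hc : z2chainOK K (n + 1) c) : z2chainOK K n (z2bdry K c) := by
  intro t ht
  obtain ⟨v, hv, h0⟩ := Finset.exists_ne_zero_of_sum_ne_zero ht
  obtain ⟨h1, h2⟩ := hc _ h0
  rw [Finset.card_insert_of_notMem (Finset.mem_sdiff.1 hv).2] at h1
  refine ⟨by omega, ?_⟩
  rcases h2 with h2 | h2
  · rcases t.eq_empty_or_nonempty with h3 | h3
    · exact Or.inr h3
    · exact Or.inl (hK.2.2 _ h2 t (Finset.subset_insert _ _) h3)
  · exact absurd h2 (Finset.insert_ne_empty _ _)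

/-- Elementary collapses preserve acyclicity. -/
theorem collapse_acyclic (K : Finset (Finset V)) (hK : IsComplex K) (τ σ : Finset V)
    (hf : IsFreeFace K τ σ) (hac : Z2Acyclic K) : Z2Acyclic ((K.erase τ).erase σ) := by
  have hcard := free_card K hK τ σ hf
  obtain ⟨hτ, hσ, hss, hu⟩ := hf
  have hτne : τ ≠ ∅ := by rintro rfl; exact hK.2.1 hτ
  obtain ⟨v, hvσ, hvτ⟩ := Finset.exists_of_ssubset hss
  have hvK : v ∈ verts K := (Finset.le_sup (f := id) hσ : σ ≤ K.sup id) hvσ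
  have hins : insert v τ = σ := by
    apply Finset.eq_of_subset_of_card_le (Finset.insert_subset hvσ hss.1)
    rw [Finset.card_insert_of_notMem hvτ, hcard]
  set K' := (K.erase τ).erase σ with hK'
  have hsub : K' ⊆ K := (Finset.erase_subset _ _).trans (Finset.erase_subset _ _)
  -- the coefficient at τ of a boundary is the coefficient at σ
  have hcoef : ∀ (m : ℕ) (d : Finset V → ZMod 2), z2chainOK K m d → z2bdry K d τ = d σ := by
    intro m d hd
    unfold z2bdry
    rw [Finset.sum_eq_single v, hins]
    · intro w hw hwv
      by_contra h0
      rcases (hd _ h0).2 with h1 | h1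
      · have h2 := hu _ h1 (Finset.ssubset_insert (Finset.mem_sdiff.1 hw).2)
        have hw' : w ∈ insert v τ := by rw [hins, ← h2]; simp
        rcases Finset.mem_insert.1 hw' with h3 | h3
        · exact hwv h3
        · exact (Finset.mem_sdiff.1 hw).2 h3
      · exact absurd h1 (Finset.insert_ne_empty _ _)
    · intro h
      exact absurd (Finset.mem_sdiff.2 ⟨hvK, hvτ⟩) h
  intro n c hc hbc
  have hcK : z2chainOK K n c := fun s hs => ⟨(hc s hs).1, (hc s hs).2.imp (fun h => hsub h) id⟩
  rw [← z2bdry_sub K K' hsub n c hc] at hbc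
  obtain ⟨c', hc', hb'⟩ := hac n c hcK hbc
  have hcτ : c τ = 0 := by
    by_contra h
    rcases (hc τ h).2 with h1 | h1
    · simp [hK'] at h1
    · exact hτne h1
  -- a chain without τ whose boundary is c
  obtain ⟨d, hd, hbd, hdτ⟩ : ∃ d, z2chainOK K (n + 1) d ∧ z2bdry K d = c ∧ d τ = 0 := by
    by_cases h0 : c' τ = 0
    · exact ⟨c', hc', hb', h0⟩
    · have hτn := (hc' τ h0).1
      have hone : z2chainOK K (n + 2) (Pi.single σ 1) := by
        intro s hs
        have : s = σ := by
          by_contra h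
          exact hs (by simp [h])
        subst this
        exact ⟨by omega, Or.inl hσ⟩
      have hbone := z2bdry_chain K hK (n + 1) _ hone
      refine ⟨c' + z2bdry K (Pi.single σ 1), ?_, ?_, ?_⟩
      · intro s hs
        by_cases h1 : c' s = 0
        · apply hbone s
          intro h2
          exact hs (by simp [h1, h2])
        · exact hc' s h1
      · rw [z2bdry_add, hb', z2bdry_z2bdry, add_zero]
      · rw [Pi.add_apply, hcoef _ _ hone]
        have hz2 : ∀ a : ZMod 2, a ≠ 0 → a + 1 = 0 := by decide
        simpa using hz2 _ h0
  have hdσ : d σ = 0 := by rw [← hcoef _ d hd, hbd, hcτ]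
  have hd' : z2chainOK K' (n + 1) d := by
    intro s hs
    obtain ⟨h1, h2⟩ := hd s hs
    refine ⟨h1, h2.imp (fun h => ?_) id⟩
    rw [hK', Finset.mem_erase, Finset.mem_erase]
    refine ⟨?_, ?_, h⟩
    · rintro rfl; exact hs hdσ
    · rintro rfl; exact hs hdτ
  exact ⟨d, hd', by rw [← z2bdry_sub K K' hsub (n + 1) d hd', hbd]⟩

/-- If every face has at most `n + 2` elements and there is no free face, then no face of
cardinality `n + 1` is contained in exactly one face of cardinality `n + 2`. -/
theorem deg_ne_one (K : Finset (Finset V)) (hK : IsComplex K) (n : ℕ)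
    (htop : ∀ s ∈ K, s.card ≤ n + 2) (hfree : ∀ τ σ, ¬ IsFreeFace K τ σ) (t : Finset V)
    (ht : t.card = n + 1) :
    ((K.filter (fun s => s.card = n + 2)).filter (fun s => t ⊆ s)).card ≠ 1 := by
  intro h
  obtain ⟨σ, hσ⟩ := Finset.card_eq_one.1 h
  have hmem : ∀ s, s ∈ K → s.card = n + 2 → t ⊆ s → s = σ := by
    intro s h1 h2 h3
    have : s ∈ (K.filter (fun s => s.card = n + 2)).filter (fun s => t ⊆ s) :=
      Finset.mem_filter.2 ⟨Finset.mem_filter.2 ⟨h1, h2⟩, h3⟩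
    rw [hσ] at this
    exact Finset.mem_singleton.1 this
  have hσm : σ ∈ (K.filter (fun s => s.card = n + 2)).filter (fun s => t ⊆ s) := by
    rw [hσ]; simp
  obtain ⟨h1, h2⟩ := Finset.mem_filter.1 hσm
  obtain ⟨h3, h4⟩ := Finset.mem_filter.1 h1
  refine hfree t σ ⟨hK.2.2 σ h3 t h2 (Finset.card_pos.1 (by omega)), h3, ?_, ?_⟩
  · refine Finset.ssubset_iff_subset_ne.2 ⟨h2, ?_⟩
    rintro rfl; omega
  · intro ρ hρ htρ
    have h5 := Finset.card_lt_card htρ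
    have h6 := htop ρ hρ
    exact hmem ρ hρ (by omega) htρ.1

theorem main_induction (m : ℕ) : ∀ K : Finset (Finset V), K.card = m → IsComplex K →
    (verts K).card ≤ 7 → (∀ s ∈ K, s.card ≤ 3) → Z2Acyclic K → Collapsible K := by
  induction m using Nat.strong_induction_on with
  | _ m ih =>
    intro K hm hK h7 hdim hac
    by_cases hfree : ∃ τ σ, IsFreeFace K τ σ
    · obtain ⟨τ, σ, hf⟩ := hfree
      have hsub : (K.erase τ).erase σ ⊆ K := (Finset.erase_subset _ _).trans (Finset.erase_subset _ _)
      have hlt : ((K.erase τ).erase σ).card < m := by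
        rw [← hm]
        exact (Finset.card_le_card (Finset.erase_subset _ _)).trans_lt
          (Finset.card_erase_lt_of_mem hf.1)
      obtain ⟨v, hv⟩ := ih _ hlt _ rfl (collapse_complex K hK τ σ hf)
        ((Finset.card_le_card (Finset.sup_mono hsub)).trans h7) (fun s hs => hdim s (hsub hs))
        (collapse_acyclic K hK τ σ hf hac)
      exact ⟨v, Relation.ReflTransGen.head ⟨τ, σ, hf, rfl⟩ hv⟩
    · push Not at hfree
      have hdim2 : ∀ s ∈ K, s.card ≤ 2 := by
        by_contra hcon
        push Not at hcon
        obtain ⟨s, hs, hs3⟩ := hcon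
        have hs3' : s.card = 3 := by have := hdim s hs; omega
        refine tri_cycle (K.filter (fun s => s.card = 1 + 2))
          (fun s hs => (Finset.mem_filter.1 hs).2) ⟨s, Finset.mem_filter.2 ⟨hs, hs3'⟩⟩ ?_
          (deg_ne_one K hK 1 hdim hfree) ?_
        · refine (Finset.card_le_card ?_).trans h7
          intro a ha
          obtain ⟨s, h1, h2⟩ := Finset.mem_biUnion.1 ha
          exact (Finset.le_sup (f := id) (Finset.mem_filter.1 h1).1 : s ≤ K.sup id) h2
        · exact no_cycle K _ 2 (Finset.filter_subset _ _)
            (fun s hs => (Finset.mem_filter.1 hs).2) hdim hac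
      have hdim1 : ∀ s ∈ K, s.card ≤ 1 := by
        by_contra hcon
        push Not at hcon
        obtain ⟨s, hs, hs3⟩ := hcon
        have hs3' : s.card = 2 := by have := hdim2 s hs; omega
        refine graph_cycle (K.filter (fun s => s.card = 0 + 2))
          (fun s hs => (Finset.mem_filter.1 hs).2) ⟨s, Finset.mem_filter.2 ⟨hs, hs3'⟩⟩
          (deg_ne_one K hK 0 hdim2 hfree) ?_
        exact no_cycle K _ 1 (Finset.filter_subset _ _)
            (fun s hs => (Finset.mem_filter.1 hs).2) hdim2 hac
      have hcard1 : ∀ s ∈ K, s.card = 1 := by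
        intro s hs
        have h1 := hdim1 s hs
        have h2 : s.card ≠ 0 := by
          intro h
          rw [Finset.card_eq_zero] at h
          subst h
          exact hK.2.1 hs
        omega
      obtain ⟨s, hs⟩ := hK.1
      obtain ⟨v, hv⟩ := Finset.card_eq_one.1 (hcard1 s hs)
      refine ⟨v, ?_⟩
      have hKs : K = {{v}} := by
        rw [← hv]
        ext t
        rw [Finset.mem_singleton]
        constructor
        · intro ht
          by_contra hts
          have hz := no_cycle K K 0 le_rfl hcard1 hdim1 hac (Pi.single s 1 + Pi.single t 1) (by
            intro r hr
            by_contra h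
            have h1 : r ≠ s := by rintro rfl; exact h hs
            have h2 : r ≠ t := by rintro rfl; exact h ht
            exact hr (by simp [h1, h2])) (by
            intro r hr
            rw [Finset.card_eq_zero] at hr
            subst hr
            rw [bdP_add, bdP_single K _ hs, bdP_single K _ ht]
            simp
            decide)
          have := congrFun hz t
          simp [hts] at this
        · rintro rfl; exact hs
      rw [hKs]
      exact Relation.ReflTransGen.refl

/-- Lemma 3.2: every 7-vertex 2-dimensional `ℤ/2`-acyclic
simplicial complex is collapsible. -/
theorem seven_vertex_two_dim_acyclic_collapsible {V : Type*} [DecidableEq V]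
    (X : Finset (Finset V)) (hX : IsComplex X) (h7 : (verts X).card = 7)
    (hdim : X.sup Finset.card = 3) (hac : Z2Acyclic X) :
    Collapsible X := by
  exact main_induction _ X rfl hX h7.le
    (fun s hs => hdim ▸ Finset.le_sup (f := Finset.card) hs) hac

end HomologySpheres
end
end
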